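/- arXiv:2009.11494 — 4 statements merged into one kernel-verified Lean document; each statement's English description precedes it below -/
import Mathlib

section
/- Lemma 2.6: Let θ_X and θ_Y be fully invariant congruences on F = FreeMonoid ℕ such that (x, x^{m+1}) ∈ θ_X for some m ≥ 1 and (x, x^{n+1}) ∈ θ_Y for some n ≥ 1 (the corresponding varieties X and Y are completely regular), and such that θ_X ⊆ θ_SL and θ_Y ⊆ θ_SL, where θ_SL = θ({x ≈ x², xy ≈ yx}) is the theory of semilattice monoids (i.e. X and Y contain the variety SL). Then θ_X and θ_Y permute: θ_X ∘ θ_Y = θ_Y ∘ θ_X. -/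
/-! Common definitions: words, fully invariant congruences, identities and
named varieties from the paper. -/

/-- The free monoid over the countably infinite alphabet `ℕ`. -/
abbrev FM : Type := FreeMonoid ℕ

/-- The letters `x, y, z, s, t, h` (pairwise distinct elements of `ℕ`). -/
def xL : FM := FreeMonoid.of 0
def yL : FM := FreeMonoid.of 1
def zL : FM := FreeMonoid.of 2
def sL : FM := FreeMonoid.of 3
def tL : FM := FreeMonoid.of 4
def hL : FM := FreeMonoid.of 5
/-- The indexed letters `z_i` and `t_i` (0-based; pairwise distinct, and distinct
from the named letters above). -/
def zV (i : ℕ) : FM := FreeMonoid.of (10 + 2 * i)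
def tV (i : ℕ) : FM := FreeMonoid.of (11 + 2 * i)

/-- A congruence on the free monoid is fully invariant if it is stable under all
monoid endomorphisms. -/
def IsFullyInvariant (θ : Con FM) : Prop :=
  ∀ (σ : FM →* FM) (u v : FM), θ u v → θ (σ u) (σ v)

/-- The smallest fully invariant congruence on `FM` containing a set of identities. -/
def fiCon (E : Set (FM × FM)) : Con FM :=
  sInf {c : Con FM | IsFullyInvariant c ∧ ∀ p ∈ E, c p.1 p.2}

/-- Two congruences (relations) permute: `α ∘ β = β ∘ α`. -/
def Permute (α β : Con FM) : Prop :=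
  Relation.Comp (⇑α) (⇑β) = Relation.Comp (⇑β) (⇑α)

/-- A monoid `M` satisfies the identity `p.1 ≈ p.2`. -/
def MSatisfies (M : Type*) [Monoid M] (p : FM × FM) : Prop :=
  ∀ φ : FM →* M, φ p.1 = φ p.2

/-- A monoid `M` satisfies all identities of a congruence `θ`. -/
def SatisfiesAll (θ : Con FM) (M : Type*) [Monoid M] : Prop :=
  ∀ u v : FM, θ u v → MSatisfies M (u, v)

/-- Every element of the monoid `M` has a two-sided inverse, i.e. `M` is a group. -/
def IsGroupMonoid (M : Type*) [Monoid M] : Prop :=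
  ∀ m : M, ∃ m' : M, m * m' = 1 ∧ m' * m = 1

/-- The dual of a congruence: `θ^δ = {(rev u, rev v) : (u, v) ∈ θ}`. -/
def dualCon (θ : Con FM) : Con FM where
  r a b := θ a.reverse b.reverse
  iseqv := ⟨fun _ => θ.refl _, fun h => θ.symm h, fun h h' => θ.trans h h'⟩
  mul' := fun {a b c d} h₁ h₂ => by
    show θ (a * c).reverse (b * d).reverse
    rw [FreeMonoid.reverse_mul, FreeMonoid.reverse_mul]
    exact θ.mul h₂ h₁

/-- σ1 : `xysxty ≈ yxsxty`. -/
def idσ1 : FM × FM := (xL*yL*sL*xL*tL*yL, yL*xL*sL*xL*tL*yL)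
/-- σ2 : `xsytxy ≈ xsytyx`. -/
def idσ2 : FM × FM := (xL*sL*yL*tL*xL*yL, xL*sL*yL*tL*yL*xL)
/-- σ3 : `xsxyty ≈ xsyxty`. -/
def idσ3 : FM × FM := (xL*sL*xL*yL*tL*yL, xL*sL*yL*xL*tL*yL)
/-- α1 : `xysxtxhy ≈ yxsxtxhy`. -/
def idα1 : FM × FM := (xL*yL*sL*xL*tL*xL*hL*yL, yL*xL*sL*xL*tL*xL*hL*yL)
/-- α2 : `xysxtyhx ≈ yxsxtyhx`. -/
def idα2 : FM × FM := (xL*yL*sL*xL*tL*yL*hL*xL, yL*xL*sL*xL*tL*yL*hL*xL)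
/-- α3 : `xysytxhx ≈ yxsytxhx`. -/
def idα3 : FM × FM := (xL*yL*sL*yL*tL*xL*hL*xL, yL*xL*sL*yL*tL*xL*hL*xL)

/-- `aIdent i` is the identity `α_i` for `i ∈ {1, 2, 3}`. -/
def aIdent (i : ℕ) : FM × FM := if i = 1 then idα1 else if i = 2 then idα2 else idα3
/-- `bIdent i` is `β_i`, obtained from `α_i` by reversing both sides. -/
def bIdent (i : ℕ) : FM × FM := ((aIdent i).1.reverse, (aIdent i).2.reverse)

/-- The ordered product `f 0 * f 1 * ⋯ * f (n-1)`. -/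
def prodRange (n : ℕ) (f : ℕ → FM) : FM := ((List.range n).map f).prod
/-- The ordered product `f 0 * f 1 * ⋯ * f (n-1)` over `Fin n`. -/
def prodFin (n : ℕ) (f : Fin n → FM) : FM := ((List.finRange n).map f).prod

/-- The word `w_n[π,τ]` (0-based indices). -/
def wWord (n : ℕ) (π τ : Equiv.Perm (Fin n)) : FM :=
  prodRange n (fun i => zV i * tV i) * xL *
    prodFin n (fun i => zV (π i) * zV (n + τ i)) * xL *
    prodRange n (fun i => tV (n + i) * zV (n + i))

/-- The word `w_n'[π,τ]`. -/
def wWord' (n : ℕ) (π τ : Equiv.Perm (Fin n)) : FM :=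
  prodRange n (fun i => zV i * tV i) * (xL * xL) *
    prodFin n (fun i => zV (π i) * zV (n + τ i)) *
    prodRange n (fun i => tV (n + i) * zV (n + i))

/-- The word `c_{n,m}[ρ]`. -/
def cWord (n m : ℕ) (ρ : Equiv.Perm (Fin (n + m))) : FM :=
  prodRange n (fun i => zV i * tV i) * (xL * yL) * tL *
    prodRange m (fun i => zV (n + i) * tV (n + i)) * xL *
    prodFin (n + m) (fun i => zV (ρ i)) * yL

/-- The word `c'_{n,m}[ρ]`. -/
def cWord' (n m : ℕ) (ρ : Equiv.Perm (Fin (n + m))) : FM :=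
  prodRange n (fun i => zV i * tV i) * (yL * xL) * tL *
    prodRange m (fun i => zV (n + i) * tV (n + i)) * xL *
    prodFin (n + m) (fun i => zV (ρ i)) * yL

/-- The word `c_{n,m,k}[ρ]`. -/
def cWord3 (n m k : ℕ) (ρ : Equiv.Perm (Fin (n + m + k))) : FM :=
  prodRange n (fun i => zV i * tV i) * (xL * yL) * tL *
    prodRange m (fun i => zV (n + i) * tV (n + i)) * xL *
    prodFin (n + m + k) (fun i => zV (ρ i)) * yL *
    prodRange k (fun i => tV (n + m + i) * zV (n + m + i))

/-- The word `c'_{n,m,k}[ρ]`. -/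
def cWord3' (n m k : ℕ) (ρ : Equiv.Perm (Fin (n + m + k))) : FM :=
  prodRange n (fun i => zV i * tV i) * (yL * xL) * tL *
    prodRange m (fun i => zV (n + i) * tV (n + i)) * xL *
    prodFin (n + m + k) (fun i => zV (ρ i)) * yL *
    prodRange k (fun i => tV (n + m + i) * zV (n + m + i))

/-- The equational theory of `D_∞`. -/
def θDinf : Con FM :=
  fiCon {(xL^2, xL^3), (xL^2 * yL, yL * xL^2), idσ1, idσ2, idσ3}
/-- The equational theory of `N`. -/
def θN : Con FM :=
  fiCon {(xL^2, xL^3), (xL^2 * yL, yL * xL^2), (xL*yL*xL*zL*xL, xL^2*yL*zL), idσ2, idσ3}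
/-- The equational theory of `K`. -/
def θK : Con FM :=
  fiCon {(xL^2*yL, xL^2*yL*xL), (xL*yL*xL, xL*yL*xL^2), (xL^2*yL^2, yL^2*xL^2)}
/-- The identity basis of `P_n`. -/
def basisP (n : ℕ) : Set (FM × FM) :=
  {(xL^n, xL^(n+1)), (xL^n * yL, yL * xL^n), (xL^2*yL, xL*yL*xL)}
/-- The equational theory of `P_n`. -/
def θP (n : ℕ) : Con FM := fiCon (basisP n)
/-- The equational theory of `R`. -/
def θR : Con FM :=
  fiCon ({(xL^2, xL^3), (xL^2*yL, yL*xL^2), idσ1, idσ2} ∪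
    {p : FM × FM | ∃ (n : ℕ) (π τ : Equiv.Perm (Fin n)),
        1 ≤ n ∧ p = (wWord n π τ, wWord' n π τ)})
/-- The equational theory of `Q_{r,s}`. -/
def θQ (r s : ℕ) : Con FM :=
  fiCon ({(xL^2, xL^3), (xL^2*yL, yL*xL^2), idσ3} ∪
    {p : FM × FM | ∃ i : ℕ, (i = 1 ∨ i = 2 ∨ i = 3) ∧ i ≠ r ∧ p = aIdent i} ∪
    {p : FM × FM | ∃ j : ℕ, (j = 1 ∨ j = 2 ∨ j = 3) ∧ j ≠ s ∧ p = bIdent j} ∪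
    {p : FM × FM | ∃ (n m : ℕ) (ρ : Equiv.Perm (Fin (n + m))),
        p = (cWord n m ρ, cWord' n m ρ) ∨
        p = ((cWord n m ρ).reverse, (cWord' n m ρ).reverse)})
/-- The equational theory of the variety `SL` of semilattice monoids. -/
def θSL : Con FM := fiCon {(xL, xL^2), (xL*yL, yL*xL)}

/-- `u` is a factor (contiguous subword) of `w`. -/
def IsFactor (u w : FM) : Prop := ∃ p q : FM, p * u * q = w

lemma isFactor_left {a b w : FM} (h : IsFactor (a * b) w) : IsFactor a w := by
  obtain ⟨p, q, hpq⟩ := h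
  exact ⟨p, b * q, by rw [← hpq]; simp [mul_assoc]⟩

lemma isFactor_right {a b w : FM} (h : IsFactor (a * b) w) : IsFactor b w := by
  obtain ⟨p, q, hpq⟩ := h
  exact ⟨p * a, q, by rw [← hpq]; simp [mul_assoc]⟩

/-- The Rees congruence associated with the ideal of non-factors of `w`. -/
def reesCon (w : FM) : Con FM where
  r u v := u = v ∨ (¬ IsFactor u w ∧ ¬ IsFactor v w)
  iseqv := by
    refine ⟨fun _ => Or.inl rfl, ?_, ?_⟩
    · intro a b h
      rcases h with rfl | ⟨h1, h2⟩
      · exact Or.inl rfl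
      · exact Or.inr ⟨h2, h1⟩
    · intro a b c h h'
      rcases h with rfl | ⟨h1, h2⟩
      · exact h'
      · rcases h' with rfl | ⟨h3, h4⟩
        · exact Or.inr ⟨h1, h2⟩
        · exact Or.inr ⟨h1, h4⟩
  mul' := by
    rintro a b c d (rfl | ⟨h1, h2⟩) (rfl | ⟨h3, h4⟩)
    · exact Or.inl rfl
    · exact Or.inr ⟨fun h => h3 (isFactor_right h), fun h => h4 (isFactor_right h)⟩
    · exact Or.inr ⟨fun h => h1 (isFactor_left h), fun h => h2 (isFactor_left h)⟩
    · exact Or.inr ⟨fun h => h1 (isFactor_left h), fun h => h2 (isFactor_left h)⟩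

/-- The Rees quotient monoid `S(w)`. -/
abbrev SMon (w : FM) : Type := (reesCon w).Quotient

/-- The number of occurrences of the letter `a` in the word `w`. -/
def occ (w : FM) (a : ℕ) : ℕ := (FreeMonoid.toList w).count a

/-- A word in which every letter occurs at most once. -/
def LinearW (w : FM) : Prop := ∀ a : ℕ, occ w a ≤ 1

/-- Assemble the word `b0 * t_1 * b_1 * ⋯ * t_m * b_m` from a first block and a list
of (simple letter, block) pairs. -/
def assemble (b0 : FM) (rest : List (ℕ × FM)) : FM :=
  b0 * (rest.map (fun p => FreeMonoid.of p.1 * p.2)).prod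

/-- `(b0, rest)` is the decomposition of `w` into alternating simple letters and blocks
consisting of multiple letters. -/
def IsDecomposition (w : FM) (b0 : FM) (rest : List (ℕ × FM)) : Prop :=
  w = assemble b0 rest ∧
  (∀ p ∈ rest, occ w p.1 = 1) ∧
  (∀ a ∈ FreeMonoid.toList b0, 2 ≤ occ w a) ∧
  (∀ p ∈ rest, ∀ a ∈ FreeMonoid.toList p.2, 2 ≤ occ w a)

/-- The identity `u ≈ v` is linear-balanced. -/
def LinearBalanced (u v : FM) : Prop :=
  ∃ (b0 c0 : FM) (urest vrest : List (ℕ × FM)),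
    IsDecomposition u b0 urest ∧ IsDecomposition v c0 vrest ∧
    urest.map Prod.fst = vrest.map Prod.fst ∧
    ∀ a : ℕ, (2 ≤ occ u a ∨ 2 ≤ occ v a) →
      occ b0 a = occ c0 a ∧ occ b0 a ≤ 1 ∧
      ∀ q ∈ urest.zip vrest, occ q.1.2 a = occ q.2.2 a ∧ occ q.1.2 a ≤ 1

/-- `w` is an isoterm for `θ`. -/
def IsIsoterm (θ : Con FM) (w : FM) : Prop := ∀ w' : FM, θ w w' → w' = w

/-- The set of letters occurring in a word. -/
def content (u : FM) : Finset ℕ := (FreeMonoid.toList u).toFinset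

lemma content_one : content 1 = ∅ := rfl

lemma content_of (a : ℕ) : content (FreeMonoid.of a) = {a} := by
  simp [content]

lemma content_mul (u v : FM) : content (u * v) = content u ∪ content v := by
  simp [content]

lemma content_pow_succ (u : FM) (n : ℕ) : content (u ^ (n + 1)) = content u := by
  induction n with
  | zero => simp
  | succ n ih => rw [pow_succ, content_mul, ih, Finset.union_self]

lemma content_reverse (u : FM) : content u.reverse = content u := by
  ext a
  exact (List.mem_toFinset.trans List.mem_reverse).trans List.mem_toFinset.symm

lemma content_map (σ : FM →* FM) (u : FM) :
    content (σ u) = (content u).biUnion fun a => content (σ (FreeMonoid.of a)) := by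
  induction u using FreeMonoid.recOn with
  | one => simp [content_one]
  | of_mul a u ih => rw [map_mul, content_mul, content_mul, Finset.union_biUnion, ih, content_of,
      Finset.singleton_biUnion]

/-- Two words are related if they have the same content. -/
def contentCon : Con FM where
  r u v := content u = content v
  iseqv := ⟨fun _ => rfl, fun h => h.symm, fun h h' => h.trans h'⟩
  mul' := fun {a b c d} h₁ h₂ => by
    show content (a * c) = content (b * d)
    have h₁ : content a = content b := h₁
    have h₂ : content c = content d := h₂
    rw [content_mul, content_mul, h₁, h₂]

lemma θSL_le_contentCon : θSL ≤ contentCon := by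
  refine sInf_le ⟨fun σ u v h => ?_, ?_⟩
  · have h : content u = content v := h
    show content (σ u) = content (σ v)
    rw [content_map, content_map, h]
  · rintro p (rfl | rfl)
    · exact (content_pow_succ xL 1).symm
    · show content (xL * yL) = content (yL * xL)
      rw [content_mul, content_mul, Finset.union_comm]

/-- Fully invariant congruences preserving contents and satisfying `x ≈ x ^ (j + 2)`. -/
structure CompletelyRegular (j : ℕ) (θ : Con FM) : Prop where
  fullyInvariant : IsFullyInvariant θ
  pow_rel : ∀ u, θ (u ^ (j + 2)) u
  content_eq : ∀ {u v}, θ u v → content u = content v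

lemma pow_mul_rel {θ : Con FM} (hfi : IsFullyInvariant θ) {m : ℕ} (h : θ xL (xL ^ (m + 1)))
    (n : ℕ) (u : FM) : θ (u ^ (m * n + 1)) u := by
  have hu : θ (u ^ (m + 1)) u := by
    have := hfi (FreeMonoid.lift fun _ => u) _ _ h
    rw [map_pow] at this
    simpa [xL] using θ.symm this
  induction n with
  | zero => simpa using θ.refl u
  | succ n ih =>
    have e : u ^ (m * (n + 1) + 1) = u ^ (m * n) * u ^ (m + 1) := by
      rw [← pow_add]; congr 1
    rw [e]
    refine θ.trans (θ.mul (θ.refl _) hu) ?_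
    rwa [← pow_succ]

lemma reverse_pow (u : FM) (n : ℕ) : (u ^ n).reverse = u.reverse ^ n := by
  induction n with
  | zero => rfl
  | succ n ih => rw [pow_succ, FreeMonoid.reverse_mul, ih, pow_succ']

/-- The conjugate of an endomorphism by word reversal. -/
def reverseConj (σ : FM →* FM) : FM →* FM where
  toFun u := (σ u.reverse).reverse
  map_one' := by
    have : (1 : FM).reverse = 1 := rfl
    rw [this, map_one, this]
  map_mul' u v := by rw [FreeMonoid.reverse_mul, map_mul, FreeMonoid.reverse_mul]

lemma CompletelyRegular.dual {j : ℕ} {θ : Con FM} (h : CompletelyRegular j θ) :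
    CompletelyRegular j (dualCon θ) where
  fullyInvariant σ u v huv := by
    have := h.fullyInvariant (reverseConj σ) _ _ huv
    simpa [reverseConj, dualCon] using this
  pow_rel u := by
    show θ (u ^ (j + 2)).reverse u.reverse
    rw [reverse_pow]
    exact h.pow_rel _
  content_eq {u v} huv := by
    have := h.content_eq (u := u.reverse) (v := v.reverse) huv
    rwa [content_reverse, content_reverse] at this

/-- Green's relation `R` modulo a congruence. -/
def GreenR (θ : Con FM) (u v : FM) : Prop := (∃ s, θ u (v * s)) ∧ ∃ t, θ v (u * t)

namespace GreenR

variable {θ : Con FM} {u v w : FM}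

lemma symm (h : GreenR θ u v) : GreenR θ v u := ⟨h.2, h.1⟩

lemma trans (h : GreenR θ u v) (h' : GreenR θ v w) : GreenR θ u w := by
  obtain ⟨⟨s, hs⟩, t, ht⟩ := h
  obtain ⟨⟨s', hs'⟩, t', ht'⟩ := h'
  refine ⟨⟨s' * s, ?_⟩, t * t', ?_⟩
  · rw [← mul_assoc]
    exact θ.trans hs (θ.mul hs' (θ.refl s))
  · rw [← mul_assoc]
    exact θ.trans ht' (θ.mul ht (θ.refl t'))

lemma of_rel (h : θ u v) : GreenR θ u v :=
  ⟨⟨1, by simpa using h⟩, 1, by simpa using θ.symm h⟩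

lemma mul_left (g : FM) (h : GreenR θ u v) : GreenR θ (g * u) (g * v) := by
  obtain ⟨⟨s, hs⟩, t, ht⟩ := h
  refine ⟨⟨s, ?_⟩, t, ?_⟩
  · rw [mul_assoc]; exact θ.mul (θ.refl g) hs
  · rw [mul_assoc]; exact θ.mul (θ.refl g) ht

lemma map (hθ : IsFullyInvariant θ) (σ : FM →* FM) (h : GreenR θ u v) :
    GreenR θ (σ u) (σ v) := by
  obtain ⟨⟨s, hs⟩, t, ht⟩ := h
  refine ⟨⟨σ s, ?_⟩, σ t, ?_⟩
  · rw [← map_mul]; exact hθ σ _ _ hs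
  · rw [← map_mul]; exact hθ σ _ _ ht

lemma content_eq {j : ℕ} (hθ : CompletelyRegular j θ) (h : GreenR θ u v) :
    content u = content v := by
  obtain ⟨⟨s, hs⟩, t, ht⟩ := h
  have hs := hθ.content_eq hs
  have ht := hθ.content_eq ht
  rw [content_mul] at hs ht
  apply Finset.Subset.antisymm
  · rw [ht]; exact Finset.subset_union_left
  · rw [hs]; exact Finset.subset_union_left

end GreenR

/-- Multiplying on the right by letters already present stays in the same `R`-class. -/
lemma CompletelyRegular.greenR_mul {j : ℕ} {θ : Con FM} (hθ : CompletelyRegular j θ)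
    (h g : FM) (hg : content g ⊆ content h) : GreenR θ h (h * g) := by
  induction g using FreeMonoid.recOn generalizing h with
  | one => rw [mul_one]; exact .of_rel (θ.refl h)
  | of_mul y g ih =>
    rw [content_mul, content_of] at hg
    have hy : y ∈ content h := hg (by simp)
    rw [← mul_assoc]
    refine GreenR.trans ?_ (ih (h * FreeMonoid.of y) ?_)
    · obtain ⟨l₁, l₂, hl⟩ := List.append_of_mem (List.mem_toFinset.1 hy)
      obtain ⟨h₁, h₂, rfl⟩ : ∃ h₁ h₂ : FM, h = h₁ * (FreeMonoid.of y * h₂) :=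
        ⟨FreeMonoid.ofList l₁, FreeMonoid.ofList l₂, hl⟩
      refine ⟨⟨h₂ * (FreeMonoid.of y * h₂) ^ j, ?_⟩, FreeMonoid.of y, θ.refl _⟩
      have := θ.mul (θ.refl h₁) (θ.symm (hθ.pow_rel (FreeMonoid.of y * h₂)))
      rw [pow_succ', pow_succ'] at this
      simpa only [mul_assoc] using this
    · rw [content_mul]
      exact (Finset.subset_union_right.trans hg).trans Finset.subset_union_left

/-- The largest congruence contained in Green's relation `R` modulo `θ`. -/
def greenRCon (θ : Con FM) : Con FM where
  r p q := ∀ g, GreenR θ (p * g) (q * g)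
  iseqv := ⟨fun _ _ => .of_rel (θ.refl _), fun h g => (h g).symm,
    fun h h' g => (h g).trans (h' g)⟩
  mul' := fun {a b c d} h₁ h₂ g => by
    have e := h₁ (c * g)
    have e' := (h₂ g).mul_left b
    simp only [mul_assoc]
    exact e.trans e'

lemma map_congr_of_content {σ τ : FM →* FM} {u : FM}
    (h : ∀ a ∈ content u, σ (FreeMonoid.of a) = τ (FreeMonoid.of a)) : σ u = τ u := by
  induction u using FreeMonoid.recOn with
  | one => rw [map_one, map_one]
  | of_mul a u ih =>
    rw [content_mul, content_of] at h
    rw [map_mul, map_mul, h a (by simp), ih fun b hb => h b (Finset.mem_union_right _ hb)]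

/-- A relation `R` for one fresh letter on the right specializes to all right factors. -/
lemma greenR_map_mul {θ : Con FM} (hθ : IsFullyInvariant θ) {p q : FM} {x : ℕ}
    (hp : x ∉ content p) (hq : x ∉ content q)
    (h : GreenR θ (p * FreeMonoid.of x) (q * FreeMonoid.of x)) (σ : FM →* FM) (g : FM) :
    GreenR θ (σ p * g) (σ q * g) := by
  let τ : FM →* FM := FreeMonoid.lift fun a => if a = x then g else σ (FreeMonoid.of a)
  have hτ : ∀ r, x ∉ content r → τ r = σ r := fun r hr =>
    map_congr_of_content fun a ha => by
      have : a ≠ x := fun e => hr (e ▸ ha)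
      simp [τ, this]
  have hx : τ (FreeMonoid.of x) = g := by simp [τ]
  simpa only [map_mul, hτ p hp, hτ q hq, hx] using h.map hθ τ

lemma CompletelyRegular.greenRCon {j : ℕ} {θ : Con FM} (hθ : CompletelyRegular j θ) :
    CompletelyRegular j (greenRCon θ) where
  fullyInvariant σ u v huv g := by
    obtain ⟨x, hx⟩ := Infinite.exists_notMem_finset (content u ∪ content v)
    rw [Finset.mem_union, not_or] at hx
    exact greenR_map_mul hθ.fullyInvariant hx.1 hx.2 (huv _) σ g
  pow_rel u g := .of_rel (θ.mul (hθ.pow_rel u) (θ.refl g))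
  content_eq {u v} huv := by simpa using (huv 1).content_eq hθ

/-- A nonempty word has a prefix ending in the letter whose first occurrence is last. -/
lemma exists_last_new_letter (u : FM) (hu : u ≠ 1) : ∃ (p : FM) (x : ℕ) (t : FM),
    u = p * FreeMonoid.of x * t ∧ x ∉ content p ∧ content t ⊆ content (p * FreeMonoid.of x) := by
  have key : ∀ l : List ℕ, l ≠ [] → ∃ (p : FM) (x : ℕ) (t : FM),
      FreeMonoid.ofList l = p * FreeMonoid.of x * t ∧ x ∉ content p ∧
        content t ⊆ content (p * FreeMonoid.of x) := by
    intro l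
    induction l using List.reverseRecOn with
    | nil => intro h; exact absurd rfl h
    | append_singleton l y ih =>
      intro _
      by_cases hy : y ∈ content (FreeMonoid.ofList l)
      · obtain ⟨p, x, t, e, hx, ht⟩ := ih (by rintro rfl; simp [content] at hy)
        refine ⟨p, x, t * FreeMonoid.of y, ?_, hx, ?_⟩
        · rw [FreeMonoid.ofList_append, e, mul_assoc]; rfl
        · rw [e, content_mul, Finset.mem_union] at hy
          rw [content_mul t, content_of y]
          exact Finset.union_subset ht
            (Finset.singleton_subset_iff.2 (hy.elim id fun h => ht h))
      · exact ⟨FreeMonoid.ofList l, y, 1, by rw [FreeMonoid.ofList_append, mul_one]; rfl, hy,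
          by simp [content_one]⟩
  exact key (FreeMonoid.toList u) hu

/-- Erasing all letters but `x` and `y`, and substituting words for these two. -/
def substPair (x y : ℕ) (b a : FM) : FM →* FM :=
  FreeMonoid.lift fun i => if i = x then b else if i = y then a else 1

lemma greenR_substPair {j : ℕ} {θ : Con FM} (hθ : CompletelyRegular j θ) {x y : ℕ} {a b p : FM}
    (hab : content a = content b) (hx : x ∉ content p) (hy : y ∈ content p) :
    GreenR θ a (substPair x y b a (p * FreeMonoid.of x)) := by
  have hpow : ∀ q : FM, x ∉ content q →
      substPair x y b a q = a ^ (FreeMonoid.toList q).count y := by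
    intro q
    induction q using FreeMonoid.recOn with
    | one => intro _; rfl
    | of_mul i q ih =>
      intro h
      rw [content_mul, content_of, Finset.mem_union, not_or, Finset.mem_singleton] at h
      rw [map_mul, ih h.2]
      by_cases hi : i = y
      · subst hi
        simp [substPair, Ne.symm h.1, pow_succ']
      · simp [substPair, Ne.symm h.1, hi]
  have hc : (FreeMonoid.toList p).count y ≠ 0 :=
    (List.count_pos_iff.2 (List.mem_toFinset.1 hy)).ne'
  obtain ⟨i, hi⟩ := Nat.exists_eq_succ_of_ne_zero hc
  have hb : substPair x y b a (FreeMonoid.of x) = b := by simp [substPair]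
  rw [map_mul, hpow p hx, hi, hb, Nat.succ_eq_add_one, pow_succ', mul_assoc]
  refine hθ.greenR_mul _ _ ?_
  cases i with
  | zero => simp [hab]
  | succ i => rw [content_mul, content_pow_succ, hab, Finset.union_self]

lemma substPair_comm {x y : ℕ} (hxy : x ≠ y) (a b : FM) :
    substPair x y b a = substPair y x a b := by
  refine FreeMonoid.hom_eq fun i => ?_
  by_cases hx : i = x
  · subst hx; simp [substPair, hxy]
  · simp [substPair, hx]

/-- If some `R`-related words have distinct last new letters, all words of equal content
are `R`-related. -/
lemma greenR_of_ne {j : ℕ} {θ : Con FM} (hθ : CompletelyRegular j θ) {x y : ℕ} {p q : FM}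
    (hxy : x ≠ y) (hx : x ∉ content p) (hy : y ∉ content q)
    (h : GreenR θ (p * FreeMonoid.of x) (q * FreeMonoid.of y)) {a b : FM}
    (hab : content a = content b) : GreenR θ a b := by
  have hc := h.content_eq hθ
  rw [content_mul, content_mul, content_of, content_of] at hc
  have hyp : y ∈ content p := by
    have : y ∈ content p ∪ {x} := hc ▸ (by simp)
    simpa [hxy.symm] using this
  have hxq : x ∈ content q := by
    have : x ∈ content q ∪ {y} := hc ▸ (by simp)
    simpa [hxy] using this
  have h₁ := greenR_substPair hθ hab hx hyp
  have h₂ := greenR_substPair hθ hab.symm hy hxq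
  rw [← substPair_comm hxy] at h₂
  exact (h₁.trans (h.map hθ.fullyInvariant _)).trans h₂.symm

/-- Permutability of `α` and `β` on words with fewer than `n` letters. -/
def PermuteBelow (j n : ℕ) : Prop :=
  ∀ α β : Con FM, CompletelyRegular j α → CompletelyRegular j β →
    ∀ u w v : FM, (content u).card < n → α u w → β w v → ∃ z, β u z ∧ α z v

lemma exists_greenR_interpolant {j n : ℕ} (ih : PermuteBelow j n) {α β : Con FM}
    (hα : CompletelyRegular j α) (hβ : CompletelyRegular j β) {u w v : FM}
    (hn : (content u).card = n) (huw : α u w) (hwv : β w v) :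
    ∃ a, GreenR β u a ∧ GreenR α a v := by
  have hcuw := hα.content_eq huw
  have hcwv := hβ.content_eq hwv
  have ne_one : ∀ {s t : FM}, content s = content t → s ≠ 1 → t ≠ 1 := by
    rintro s t hst hs rfl
    rw [content_one] at hst
    exact hs (List.toFinset_eq_empty_iff _ |>.1 hst)
  by_cases hu : u = 1
  · have hw : w = 1 := by
      by_contra hw
      exact ne_one hcuw.symm hw hu
    exact ⟨v, .of_rel (hu ▸ hw ▸ hwv), .of_rel (α.refl v)⟩
  have hw := ne_one hcuw hu
  have hv := ne_one hcwv hw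
  obtain ⟨p, x, t, rfl, hx, ht⟩ := exists_last_new_letter u hu
  obtain ⟨q, y, t', rfl, hy, ht'⟩ := exists_last_new_letter w hw
  obtain ⟨r, z, t'', rfl, hz, ht''⟩ := exists_last_new_letter v hv
  have hpq : GreenR α (p * FreeMonoid.of x) (q * FreeMonoid.of y) :=
    ((hα.greenR_mul _ _ ht).trans (.of_rel huw)).trans (hα.greenR_mul _ _ ht').symm
  have hqr : GreenR β (q * FreeMonoid.of y) (r * FreeMonoid.of z) :=
    ((hβ.greenR_mul _ _ ht').trans (.of_rel hwv)).trans (hβ.greenR_mul _ _ ht'').symm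
  by_cases hxy : x = y
  swap
  · exact ⟨_, .of_rel (β.refl _), greenR_of_ne hα hxy hx hy hpq (hcuw.trans hcwv)⟩
  by_cases hyz : y = z
  swap
  · exact ⟨_, greenR_of_ne hβ hyz hy hz hqr (hcuw.trans hcwv), .of_rel (α.refl _)⟩
  subst hxy hyz
  have hcard : (content p).card < n := by
    rw [← hn]
    refine Finset.card_lt_card ⟨?_, fun h => hx (h ?_)⟩
    · rw [content_mul, content_mul]
      exact Finset.subset_union_left.trans Finset.subset_union_left
    · simp [content_mul, content_of]
  obtain ⟨s, hps, hsr⟩ := ih _ _ hα.greenRCon hβ.greenRCon p q r hcard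
    (fun g => greenR_map_mul hα.fullyInvariant hx hy hpq (MonoidHom.id _) g)
    (fun g => greenR_map_mul hβ.fullyInvariant hy hz hqr (MonoidHom.id _) g)
  exact ⟨s * FreeMonoid.of x, (hβ.greenR_mul _ _ ht).symm.trans (hps _),
    (hsr _).trans (hα.greenR_mul _ _ ht'')⟩

section Monoid

variable {M : Type*} [Monoid M] {j : ℕ}

lemma pow_mul_of_eq_mul (hj : ∀ c : M, c ^ (j + 2) = c) {u a s : M} (h : u = a * s) :
    a ^ (j + 1) * u = u := by
  rw [h, ← mul_assoc, ← pow_succ, hj]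

lemma mul_pow_of_eq_mul (hj : ∀ c : M, c ^ (j + 2) = c) {u b t : M} (h : u = t * b) :
    u * b ^ (j + 1) = u := by
  rw [h, mul_assoc, ← pow_succ', hj]

/-- The Mal'cev term of the maximal subgroup in the `R`-class of `a` and `L`-class of `b`. -/
def malcev (j : ℕ) (a b u w v : M) : M :=
  (a ^ (j + 1) * u * b ^ (j + 1)) * (a ^ (j + 1) * w * b ^ (j + 1)) ^ (2 * j + 1) *
    (a ^ (j + 1) * v * b ^ (j + 1))

lemma malcev_right_eq (hj : ∀ c : M, c ^ (j + 2) = c) {a b u v s t c : M}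
    (ha : u = a * s) (hb : u = t * b) (hc : u = c * (a ^ (j + 1) * v * b ^ (j + 1))) :
    malcev j a b u v v = u := by
  have h := mul_pow_of_eq_mul hj hc
  rw [malcev, pow_mul_of_eq_mul hj ha, mul_pow_of_eq_mul hj hb, mul_assoc, ← pow_succ,
    show 2 * j + 1 + 1 = (j + 1) + (j + 1) by ring, pow_add, ← mul_assoc, h, h]

lemma malcev_left_eq (hj : ∀ c : M, c ^ (j + 2) = c) {a b u v s t c : M}
    (ha : v = a * s) (hb : v = t * b) (hc : v = (a ^ (j + 1) * u * b ^ (j + 1)) * c) :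
    malcev j a b u u v = v := by
  have h := pow_mul_of_eq_mul hj hc
  rw [malcev, pow_mul_of_eq_mul hj ha, mul_pow_of_eq_mul hj hb, ← pow_succ',
    show 2 * j + 1 + 1 = (j + 1) + (j + 1) by ring, pow_add, mul_assoc, h, h]

end Monoid

lemma CompletelyRegular.quotient_pow {j : ℕ} {θ : Con FM} (hθ : CompletelyRegular j θ)
    (c : θ.Quotient) : c ^ (j + 2) = c := by
  induction c using Con.induction_on with
  | H u => exact (Con.eq θ).2 (hθ.pow_rel u)

lemma CompletelyRegular.greenR_sandwich {j : ℕ} {θ : Con FM} (hθ : CompletelyRegular j θ)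
    {a b w : FM} (hb : content b = content a) (hw : content w = content a) :
    GreenR θ a (a ^ (j + 1) * w * b ^ (j + 1)) := by
  rw [pow_succ' a, mul_assoc, mul_assoc]
  refine hθ.greenR_mul _ _ ?_
  rw [content_mul, content_mul, content_pow_succ, hb, hw, Finset.union_self]
  cases j with
  | zero => simp [content_one]
  | succ j => rw [content_pow_succ, Finset.union_self]

lemma permuteBelow (j n : ℕ) : PermuteBelow j n := by
  induction n with
  | zero => intro _ _ _ _ _ _ _ h; exact absurd h (Nat.not_lt_zero _)
  | succ n ih =>
    intro α β hα hβ u w v hn huw hwv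
    rcases Nat.lt_succ_iff_lt_or_eq.1 hn with hn | hn
    · exact ih α β hα hβ u w v hn huw hwv
    obtain ⟨a, hua, hav⟩ := exists_greenR_interpolant ih hα hβ hn huw hwv
    obtain ⟨b, hub, hbv⟩ := exists_greenR_interpolant (u := u.reverse) (w := w.reverse)
      (v := v.reverse) ih hα.dual hβ.dual (by rwa [content_reverse])
      (by simpa [dualCon] using huw) (by simpa [dualCon] using hwv)
    have cuw := hα.content_eq huw
    have cua := hua.content_eq hβ
    have cub := hub.content_eq hβ.dual
    rw [content_reverse] at cub
    have cwa : content w = content a := cuw.symm.trans cua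
    have hb : content b.reverse = content a := by rw [content_reverse, ← cub, cua]
    have rev : ∀ {θ : Con FM}, CompletelyRegular j θ → GreenR (dualCon θ) b
        (a ^ (j + 1) * w * b.reverse ^ (j + 1)).reverse := by
      intro θ hθ
      have := hθ.dual.greenR_sandwich (a := b) (b := a.reverse) (w := w.reverse)
        (by rw [content_reverse, ← cua, cub]) (by rw [content_reverse, ← cuw, cub])
      simpa [FreeMonoid.reverse_mul, reverse_pow, mul_assoc] using this
    have unrev : ∀ {θ : Con FM} {s t : FM}, GreenR (dualCon θ) s t →
        ∃ c, θ s.reverse (c * t.reverse) := by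
      rintro θ s t ⟨⟨c, hc⟩, -⟩
      refine ⟨c.reverse, ?_⟩
      rw [← FreeMonoid.reverse_mul]
      exact hc
    refine ⟨malcev j a b.reverse u w v, ?_, ?_⟩
    · obtain ⟨s, hs⟩ := hua.1
      obtain ⟨t, ht⟩ := unrev hub
      obtain ⟨c, hc⟩ := unrev (hub.trans (rev hβ))
      simp only [FreeMonoid.reverse_reverse] at ht hc
      have hwv' : (w : β.Quotient) = v := (Con.eq β).2 hwv
      have hc' : (u : β.Quotient) = c * (a ^ (j + 1) * v * (b.reverse : FM) ^ (j + 1)) := by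
        rw [← hwv']
        exact (Con.eq β).2 hc
      have := malcev_right_eq hβ.quotient_pow (a := (a : β.Quotient)) (s := s) (t := t) ((Con.eq β).2 hs)
        ((Con.eq β).2 ht) hc'
      refine β.symm ((Con.eq β).1 (Eq.trans ?_ this))
      show malcev j (a : β.Quotient) (b.reverse : FM) u w v = _
      rw [hwv']
    · obtain ⟨s, hs⟩ := hav.2
      obtain ⟨t, ht⟩ := unrev hbv.symm
      obtain ⟨c, hc⟩ := (hav.symm.trans (hα.greenR_sandwich hb cwa)).1
      simp only [FreeMonoid.reverse_reverse] at ht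
      have huw' : (u : α.Quotient) = w := (Con.eq α).2 huw
      have hc' : (v : α.Quotient) = (a ^ (j + 1) * u * (b.reverse : FM) ^ (j + 1)) * c := by
        rw [huw']
        exact (Con.eq α).2 hc
      have := malcev_left_eq hα.quotient_pow (a := (a : α.Quotient)) (s := s) (t := t) ((Con.eq α).2 hs)
        ((Con.eq α).2 ht) hc'
      refine (Con.eq α).1 (Eq.trans ?_ this)
      show malcev j (a : α.Quotient) (b.reverse : FM) u w v = _
      rw [huw']

/-- **Lemma 2.6.** The equational theories of two completely regular monoid
varieties containing `SL` permute. -/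
theorem completely_regular_theories_permute (θX θY : Con FM)
    (hfiX : IsFullyInvariant θX) (hfiY : IsFullyInvariant θY)
    (hcrX : ∃ m : ℕ, 1 ≤ m ∧ θX xL (xL ^ (m + 1)))
    (hcrY : ∃ n : ℕ, 1 ≤ n ∧ θY xL (xL ^ (n + 1)))
    (hXSL : θX ≤ θSL) (hYSL : θY ≤ θSL) :
    Permute θX θY := by
  obtain ⟨m, hm, hX⟩ := hcrX
  obtain ⟨n, hn, hY⟩ := hcrY
  obtain ⟨j, hj⟩ : ∃ j, m * n = j + 1 :=
    Nat.exists_eq_succ_of_ne_zero (Nat.mul_pos hm hn).ne'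
  have hX' : CompletelyRegular j θX :=
    ⟨hfiX, fun u => by simpa only [hj] using pow_mul_rel hfiX hX n u,
      fun h => θSL_le_contentCon (hXSL h)⟩
  have hY' : CompletelyRegular j θY :=
    ⟨hfiY, fun u => by simpa only [mul_comm n m, hj] using pow_mul_rel hfiY hY m u,
      fun h => θSL_le_contentCon (hYSL h)⟩
  funext u v
  refine propext ⟨?_, ?_⟩
  · rintro ⟨w, h₁, h₂⟩
    exact permuteBelow j _ θX θY hX' hY' u w v (Nat.lt_succ_self _) h₁ h₂
  · rintro ⟨w, h₁, h₂⟩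
    exact permuteBelow j _ θY θX hY' hX' u w v (Nat.lt_succ_self _) h₁ h₂
end

section
/- Lemma 3.1: Let θ be a fully invariant congruence on F = FreeMonoid ℕ, let k ≥ 1, and suppose the word x t₁ x t₂ x ⋯ t_k x (over pairwise distinct letters x, t₁, …, t_k; it has k+1 occurrences of x) is an isoterm for θ. Let u ∈ F be a word all of whose blocks are linear words and such that occ_a(u) ≤ k+1 for every letter a. Then every pair (u, v) ∈ θ is a linear-balanced identity. -/
/-- The word `x t₁ x t₂ x ⋯ t_k x`. -/
def xtkWord (k : ℕ) : FM := xL * prodRange k (fun i => tV i * xL)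

/-- The number of occurrences of `a` before the first occurrence of `p` in `w`. -/
def countBefore (w : List ℕ) (a p : ℕ) : ℕ := (w.takeWhile (fun b => b ≠ p)).count a

lemma countBefore_le_count (w : List ℕ) (a p : ℕ) : countBefore w a p ≤ w.count a :=
  (List.takeWhile_sublist _).count_le a

lemma countBefore_self (w : List ℕ) (p : ℕ) : countBefore w p p = 0 := by
  rw [countBefore, List.count_eq_zero]
  intro h
  simpa using List.mem_takeWhile_imp h

lemma countBefore_append {A : List ℕ} {p : ℕ} (hp : p ∉ A) (B : List ℕ) (a : ℕ) :
    countBefore (A ++ B) a p = A.count a + countBefore B a p := by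
  have h : ∀ b ∈ A, (decide (b ≠ p)) = true := by
    intro b hb
    simpa using fun e : b = p => hp (e ▸ hb)
  rw [countBefore, List.takeWhile_append_of_pos h, List.count_append, countBefore]

lemma countBefore_append_cons_self {A : List ℕ} {p : ℕ} (hp : p ∉ A) (B : List ℕ) (a : ℕ) :
    countBefore (A ++ p :: B) a p = A.count a := by
  rw [countBefore_append hp]
  simp [countBefore]

lemma countBefore_filterMap {g : ℕ → Option ℕ} {a a' p p' : ℕ}
    (ha : ∀ b, g b = some a' ↔ b = a) (hp : ∀ b, g b = some p' ↔ b = p) (w : List ℕ) :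
    countBefore (w.filterMap g) a' p' = countBefore w a p := by
  induction w with
  | nil => rfl
  | cons b w ih =>
    have hab := ha b
    have hpb := hp b
    simp only [countBefore, ne_eq, decide_not] at ih ⊢
    cases hb : g b with
    | none =>
      rw [hb] at hab hpb
      have h1 : b ≠ a := by simpa using hab
      have h2 : b ≠ p := by simpa using hpb
      simp [hb, h1, h2, ih]
    | some c =>
      rw [hb, Option.some_inj] at hab hpb
      by_cases h2 : b = p
      · rw [List.filterMap_cons_some hb]
        simp [h2, hpb.2 h2]
      · have h3 : c ≠ p' := fun h => h2 (hpb.1 h)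
        by_cases h1 : b = a
        · rw [List.filterMap_cons_some hb, List.takeWhile_cons_of_pos (by simpa using h3),
            List.takeWhile_cons_of_pos (by simpa using h2), hab.2 h1, h1, List.count_cons_self,
            List.count_cons_self, ih]
        · have h4 : c ≠ a' := fun h => h1 (hab.1 h)
          simp [hb, h1, h2, h3, h4, ih]

lemma count_filterMap {g : ℕ → Option ℕ} {a a' : ℕ}
    (ha : ∀ b, g b = some a' ↔ b = a) (w : List ℕ) :
    (w.filterMap g).count a' = w.count a := by
  induction w with
  | nil => rfl
  | cons b w ih =>
    have hab := ha b
    cases hb : g b with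
    | none =>
      rw [hb] at hab
      have h1 : b ≠ a := by simpa using hab
      simp [hb, h1, ih]
    | some c =>
      rw [hb, Option.some_inj] at hab
      by_cases h1 : b = a
      · rw [List.filterMap_cons_some hb, hab.2 h1, h1, List.count_cons_self,
          List.count_cons_self, ih]
      · have h4 : c ≠ a' := fun h => h1 (hab.1 h)
        simp [hb, h1, h4, ih]

lemma filterMap_eq_replicate {g : ℕ → Option ℕ} {a a' : ℕ} (ha : g a = some a') {w : List ℕ}
    (hw : ∀ b ∈ w, b ≠ a → g b = none) :
    w.filterMap g = List.replicate (w.count a) a' := by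
  induction w with
  | nil => rfl
  | cons b w ih =>
    have ih := ih fun c hc => hw c (List.mem_cons_of_mem _ hc)
    by_cases h : b = a
    · subst h
      simp [ha, ih, List.replicate_succ]
    · simp [hw b List.mem_cons_self h, h, ih]

lemma xtkWord_succ (n : ℕ) : xtkWord (n + 1) = xtkWord n * (tV n * xL) := by
  simp [xtkWord, prodRange, List.range_succ, mul_assoc]

lemma toList_xtkWord_succ (n : ℕ) :
    FreeMonoid.toList (xtkWord (n + 1)) = FreeMonoid.toList (xtkWord n) ++ [11 + 2 * n, 0] := by
  rw [xtkWord_succ]; rfl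

lemma filterMap_eq_xtkWord {g : ℕ → Option ℕ} {a : ℕ} {p : ℕ → ℕ} (ha : g a = some 0) :
    ∀ (n : ℕ) (w : List ℕ), w.count a = n + 1 → (∀ i < n, w.count (p i) = 1) →
      (∀ i < n, countBefore w a (p i) = i + 1) → (∀ i < n, g (p i) = some (11 + 2 * i)) →
      (∀ b ∈ w, b ≠ a → (∀ i < n, b ≠ p i) → g b = none) →
      w.filterMap g = FreeMonoid.toList (xtkWord n) := by
  intro n
  induction n with
  | zero =>
    intro w hc _ _ _ hg
    rw [filterMap_eq_replicate ha fun b hb hba => hg b hb hba (by simp), hc]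
    rfl
  | succ n ih =>
    intro w hc h1 hb hp hg
    have hmem : p n ∈ w := List.count_pos_iff.1 (by rw [h1 n (by omega)]; omega)
    obtain ⟨A, B, rfl, hA⟩ := List.eq_append_cons_of_mem hmem
    have hpa : p n ≠ a := by
      intro h
      have := hb n (by omega)
      rw [h, countBefore_self] at this
      omega
    have hAc : A.count a = n + 1 := by
      rw [← countBefore_append_cons_self hA B, hb n (by omega)]
    have hBc : B.count a = 1 := by
      rw [List.count_append, List.count_cons_of_ne hpa] at hc
      omega
    have hpA : ∀ i < n, p i ∈ A := by
      intro i hi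
      by_contra h
      have := hb i (by omega)
      rw [countBefore_append h] at this
      omega
    have hpA1 : ∀ i < n, A.count (p i) = 1 ∧ p i ∉ B := by
      intro i hi
      have h2 := h1 i (by omega)
      have h3 := List.count_pos_iff.2 (hpA i hi)
      have h4 := List.count_le_count_cons (a := p i) (b := p n) (l := B)
      rw [List.count_append] at h2
      exact ⟨by omega, List.count_eq_zero.1 (by omega)⟩
    have hpB : p n ∉ B := by
      have h2 := h1 n (by omega)
      rw [List.count_append, List.count_cons_self] at h2
      exact List.count_eq_zero.1 (by omega)
    rw [List.filterMap_append, List.filterMap_cons_some (hp n (by omega)), toList_xtkWord_succ,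
      ih A hAc (fun i hi => (hpA1 i hi).1) _ (fun i hi => hp i (by omega)) _,
      filterMap_eq_replicate ha _, hBc]
    · rfl
    · intro b hbB hba
      refine hg b (by simp [hbB]) hba fun i hi e => ?_
      rcases Nat.lt_succ_iff_lt_or_eq.1 hi with h | rfl
      · exact (hpA1 i h).2 (e ▸ hbB)
      · exact hpB (e ▸ hbB)
    · intro i hi
      obtain ⟨C, D, rfl, hC⟩ := List.eq_append_cons_of_mem (hpA i hi)
      have := hb i (by omega)
      rw [List.append_assoc, List.cons_append, countBefore_append_cons_self hC] at this
      rw [countBefore_append_cons_self hC, this]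
    · intro b hbA hba hbp
      refine hg b (by simp [hbA]) hba fun i hi e => ?_
      rcases Nat.lt_succ_iff_lt_or_eq.1 hi with h | rfl
      · exact hbp i h e
      · exact hA (e ▸ hbA)

/-- The endomorphism that renames or deletes letters according to `g`. -/
def renameHom (g : ℕ → Option ℕ) : FM →* FM :=
  FreeMonoid.lift fun b => FreeMonoid.ofList (g b).toList

lemma toList_renameHom (g : ℕ → Option ℕ) (w : FM) :
    FreeMonoid.toList (renameHom g w) = (FreeMonoid.toList w).filterMap g := by
  induction w using FreeMonoid.inductionOn' with
  | one => rfl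
  | of_mul b w ih =>
    rw [map_mul, FreeMonoid.toList_mul, ih, FreeMonoid.toList_mul, FreeMonoid.toList_of,
      List.filterMap_append, renameHom, FreeMonoid.lift_eval_of]
    cases h : g b <;> simp [h]

lemma IsIsoterm.of_mul_left {θ : Con FM} {a b : FM} (h : IsIsoterm θ (a * b)) :
    IsIsoterm θ a :=
  fun w' hw => mul_right_cancel (h (w' * b) (θ.mul hw (θ.refl b)))

lemma IsIsoterm.xtkWord_of_le {θ : Con FM} {k n : ℕ} (h : IsIsoterm θ (xtkWord k))
    (hn : n ≤ k) : IsIsoterm θ (xtkWord n) := by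
  induction k, hn using Nat.le_induction with
  | base => exact h
  | succ k _ ih => exact ih (xtkWord_succ k ▸ h).of_mul_left

lemma IsIsoterm.filterMap_eq {θ : Con FM} (hθ : IsFullyInvariant θ) {c : FM}
    (hc : IsIsoterm θ c) {u v : FM} (huv : θ u v) {g : ℕ → Option ℕ}
    (hg : (FreeMonoid.toList u).filterMap g = FreeMonoid.toList c) :
    (FreeMonoid.toList v).filterMap g = (FreeMonoid.toList u).filterMap g := by
  have h := hθ (renameHom g) u v huv
  rw [← toList_renameHom] at hg
  rw [← toList_renameHom, ← toList_renameHom, hg]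
  rw [FreeMonoid.toList.injective hg] at h
  exact congrArg _ (hc _ h)

lemma separated_letter_eq {θ : Con FM} (hθ : IsFullyInvariant θ) {n : ℕ}
    (hiso : IsIsoterm θ (xtkWord n)) {u v : FM} (huv : θ u v) {a : ℕ} {p : ℕ → ℕ}
    (hc : occ u a = n + 1) (h1 : ∀ i < n, occ u (p i) = 1)
    (hb : ∀ i < n, countBefore (FreeMonoid.toList u) a (p i) = i + 1) :
    occ v a = n + 1 ∧ ∀ i < n, countBefore (FreeMonoid.toList v) a (p i) = i + 1 := by
  classical
  have hinj : ∀ i < n, ∀ j < n, p i = p j → i = j := by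
    intro i hi j hj h
    have h2 := hb i hi
    rw [h, hb j hj] at h2
    omega
  have hpa : ∀ i < n, p i ≠ a := by
    intro i hi h
    have := hb i hi
    rw [h, countBefore_self] at this
    omega
  let g : ℕ → Option ℕ := fun b =>
    if b = a then some 0 else if h : ∃ i < n, p i = b then some (11 + 2 * h.choose) else none
  have hga : g a = some 0 := by simp [g]
  have hgp : ∀ i < n, g (p i) = some (11 + 2 * i) := by
    intro i hi
    have h : ∃ j < n, p j = p i := ⟨i, hi, rfl⟩
    have h2 : h.choose = i := hinj _ h.choose_spec.1 _ hi h.choose_spec.2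
    simp only [g]
    rw [if_neg (hpa i hi), dif_pos h, h2]
  have hgn : ∀ b, b ≠ a → (∀ i < n, b ≠ p i) → g b = none := by
    intro b hba hbp
    simp only [g]
    rw [if_neg hba, dif_neg]
    rintro ⟨i, hi, e⟩
    exact hbp i hi e.symm
  have hcases : ∀ b, b = a ∨ (∃ i < n, b = p i) ∨ g b = none := by
    intro b
    by_cases h : b = a
    · exact .inl h
    by_cases h' : ∃ i < n, b = p i
    · exact .inr (.inl h')
    · push Not at h'
      exact .inr (.inr (hgn b h h'))
  have hga' : ∀ b, g b = some 0 ↔ b = a := by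
    intro b
    refine ⟨fun h => ?_, fun h => h ▸ hga⟩
    rcases hcases b with h' | ⟨i, hi, rfl⟩ | h'
    · exact h'
    · rw [hgp i hi] at h
      simp at h
    · simp [h'] at h
  have hgp' : ∀ i < n, ∀ b, g b = some (11 + 2 * i) ↔ b = p i := by
    intro i hi b
    refine ⟨fun h => ?_, fun h => h ▸ hgp i hi⟩
    rcases hcases b with rfl | ⟨j, hj, rfl⟩ | h'
    · rw [hga] at h
      simp at h
      omega
    · rw [hgp j hj] at h
      have : j = i := by simpa using h
      rw [this]
    · simp [h'] at h
  have key := hiso.filterMap_eq hθ huv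
    (filterMap_eq_xtkWord hga n _ hc h1 hb hgp fun b _ => hgn b)
  constructor
  · rw [← hc, occ, occ, ← count_filterMap hga', key, count_filterMap hga']
  · intro i hi
    rw [← hb i hi, ← countBefore_filterMap hga' (hgp' i hi), key,
      countBefore_filterMap hga' (hgp' i hi)]

lemma simple_letter_before {θ : Con FM} (hθ : IsFullyInvariant θ)
    (hiso : IsIsoterm θ (xtkWord 1)) {u v : FM} (huv : θ u v) {a p : ℕ}
    (ha : occ u a = 1) (hp : occ u p = 1)
    (hb : countBefore (FreeMonoid.toList u) a p = 1) :
    countBefore (FreeMonoid.toList v) a p = 1 := by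
  have hpa : p ≠ a := by
    rintro rfl
    rw [countBefore_self] at hb
    omega
  have hiso2 : IsIsoterm θ (xtkWord 0 * tV 0) := by
    rw [xtkWord_succ, ← mul_assoc] at hiso
    exact hiso.of_mul_left
  let g : ℕ → Option ℕ := fun b => if b = a then some 0 else if b = p then some 11 else none
  have hga : ∀ b, g b = some 0 ↔ b = a := by
    intro b; simp only [g]; split_ifs <;> simp_all
  have hgp : ∀ b, g b = some 11 ↔ b = p := by
    intro b; simp only [g]; split_ifs <;> simp_all
    exact fun h => hpa h.symm
  have hgn : ∀ b, b ≠ a → b ≠ p → g b = none := by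
    intro b h1 h2; simp [g, h1, h2]
  have hu : (FreeMonoid.toList u).filterMap g = FreeMonoid.toList (xtkWord 0 * tV 0) := by
    rw [occ] at ha hp
    have hmem : p ∈ FreeMonoid.toList u := List.count_pos_iff.1 (by omega)
    obtain ⟨A, B, hAB, hA⟩ := List.eq_append_cons_of_mem hmem
    rw [hAB] at ha hp hb ⊢
    rw [countBefore_append_cons_self hA] at hb
    rw [List.count_append, List.count_cons_of_ne hpa] at ha
    rw [List.count_append, List.count_cons_self] at hp
    have hpB : p ∉ B := List.count_eq_zero.1 (by omega)
    have hBa : B.count a = 0 := by omega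
    rw [List.filterMap_append, List.filterMap_cons_some ((hgp p).2 rfl),
      filterMap_eq_replicate ((hga a).2 rfl) fun b h h' => hgn b h' fun e => hA (e ▸ h),
      filterMap_eq_replicate ((hga a).2 rfl) fun b h h' => hgn b h' fun e => hpB (e ▸ h), hb, hBa]
    rfl
  rw [← hb, ← countBefore_filterMap hga hgp, hiso2.filterMap_eq hθ huv hu,
    countBefore_filterMap hga hgp]

lemma occ_eq_zero_of_isoterm {θ : Con FM} (hθ : IsFullyInvariant θ) {k : ℕ}
    (hiso : IsIsoterm θ (xtkWord k)) {u v : FM} (huv : θ u v) {a : ℕ} (ha : occ u a = 0) :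
    occ v a = 0 := by
  have hone : IsIsoterm θ 1 := (one_mul (xtkWord k) ▸ hiso).of_mul_left
  let g : ℕ → Option ℕ := fun b => if b = a then some 0 else none
  have hga : ∀ b, g b = some 0 ↔ b = a := by
    intro b; simp [g]
  have hu : (FreeMonoid.toList u).filterMap g = FreeMonoid.toList 1 := by
    rw [filterMap_eq_replicate ((hga a).2 rfl) fun b _ h => by simp [g, h]]
    rw [occ] at ha
    rw [ha]
    rfl
  rw [← ha, occ, occ, ← count_filterMap hga, hone.filterMap_eq hθ huv hu, count_filterMap hga]

lemma toList_assemble_cons (b0 : FM) (p : ℕ × FM) (rest : List (ℕ × FM)) :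
    FreeMonoid.toList (assemble b0 (p :: rest)) =
      FreeMonoid.toList b0 ++ p.1 :: FreeMonoid.toList (assemble p.2 rest) := by
  simp [assemble, mul_assoc]

lemma simple_of_simple_assemble_cons {b0 : FM} {q : ℕ × FM} {rest : List (ℕ × FM)}
    (h : ∀ p ∈ q :: rest, occ (assemble b0 (q :: rest)) p.1 = 1) :
    ∀ p ∈ rest, occ (assemble q.2 rest) p.1 = 1 ∧ p.1 ∉ FreeMonoid.toList b0 ++ [q.1] := by
  intro p hp
  have hp1 := h p (List.mem_cons_of_mem _ hp)
  have hpm : p.1 ∈ FreeMonoid.toList (assemble q.2 rest) := by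
    obtain ⟨l₁, l₂, rfl⟩ := List.append_of_mem hp
    simp [assemble]
  rw [occ, toList_assemble_cons, List.append_cons, List.count_append] at hp1
  have := List.count_pos_iff.2 hpm
  exact ⟨by rw [occ]; omega, List.count_eq_zero.1 (by omega)⟩

lemma exists_separator {a : ℕ} (rest : List (ℕ × FM)) :
    ∀ (b0 : FM), (∀ p ∈ rest, p.1 ≠ a) → (∀ p ∈ rest, occ p.2 a ≤ 1) →
      (∀ p ∈ rest, occ (assemble b0 rest) p.1 = 1) →
      ∀ i, occ b0 a ≤ i → i < occ (assemble b0 rest) a →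
        ∃ p ∈ rest, countBefore (FreeMonoid.toList (assemble b0 rest)) a p.1 = i := by
  induction rest with
  | nil =>
    intro b0 _ _ _ i h1 h2
    simp [assemble] at h2
    omega
  | cons q rest ih =>
    intro b0 hne hlin hsimp i h1 h2
    have hq := hsimp q List.mem_cons_self
    have hqa := hne q List.mem_cons_self
    rw [occ, toList_assemble_cons, List.count_append] at hq h2
    rw [List.count_cons_self] at hq
    rw [List.count_cons_of_ne hqa] at h2
    have hq0 : q.1 ∉ FreeMonoid.toList b0 := List.count_eq_zero.1 (by omega)
    have hq1 : q.1 ∉ FreeMonoid.toList (assemble q.2 rest) := List.count_eq_zero.1 (by omega)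
    rw [occ] at h1
    rcases h1.eq_or_lt with h | h
    · refine ⟨q, List.mem_cons_self, ?_⟩
      rw [toList_assemble_cons, countBefore_append_cons_self hq0, h]
    · have hmem := simple_of_simple_assemble_cons hsimp
      obtain ⟨p, hp, hpi⟩ := ih q.2 (fun p hp => hne p (List.mem_cons_of_mem _ hp))
        (fun p hp => hlin p (List.mem_cons_of_mem _ hp)) (fun p hp => (hmem p hp).1)
        (i - (FreeMonoid.toList b0).count a)
        (by have := hlin q List.mem_cons_self; omega) (by rw [occ]; omega)
      refine ⟨p, List.mem_cons_of_mem _ hp, ?_⟩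
      rw [toList_assemble_cons, List.append_cons, countBefore_append (hmem p hp).2, hpi,
        List.count_append, List.count_singleton]
      simp [hqa]
      omega

lemma exists_parallel_assemble (rest : List (ℕ × FM)) :
    ∀ (b0 v : FM), (∀ a, occ v a = occ (assemble b0 rest) a) →
      (∀ p ∈ rest, occ (assemble b0 rest) p.1 = 1) →
      (∀ p ∈ rest, ∀ a, countBefore (FreeMonoid.toList v) a p.1 =
        countBefore (FreeMonoid.toList (assemble b0 rest)) a p.1) →
      ∃ (c0 : FM) (vrest : List (ℕ × FM)), v = assemble c0 vrest ∧ (∀ a, occ b0 a = occ c0 a) ∧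
        List.Forall₂ (fun p q => p.1 = q.1 ∧ ∀ a, occ p.2 a = occ q.2 a) rest vrest := by
  induction rest with
  | nil =>
    intro b0 v hocc _ _
    exact ⟨v, [], by simp [assemble], fun a => by rw [hocc a]; simp [assemble], .nil⟩
  | cons q rest ih =>
    intro b0 v hocc hsimp hbef
    have hq := hsimp q List.mem_cons_self
    have hqv := hocc q.1
    rw [hq, occ] at hqv
    have hmem : q.1 ∈ FreeMonoid.toList v := List.count_pos_iff.1 (by omega)
    obtain ⟨A, B, hv, hA⟩ := List.eq_append_cons_of_mem hmem
    rw [occ, toList_assemble_cons, List.count_append, List.count_cons_self] at hq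
    have hq0 : q.1 ∉ FreeMonoid.toList b0 := List.count_eq_zero.1 (by omega)
    have hAb : ∀ a, (FreeMonoid.toList b0).count a = A.count a := by
      intro a
      have := hbef q List.mem_cons_self a
      rw [hv, toList_assemble_cons, countBefore_append_cons_self hA,
        countBefore_append_cons_self hq0] at this
      exact this.symm
    have hmem := simple_of_simple_assemble_cons hsimp
    obtain ⟨c1, vrest, hB, hc1, hF⟩ := ih q.2 (FreeMonoid.ofList B)
      (by
        intro a
        have := hocc a
        rw [occ, hv, occ, toList_assemble_cons, List.count_append, List.count_append, hAb,
          List.count_cons, List.count_cons] at this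
        rw [occ, occ, FreeMonoid.toList_ofList]
        omega)
      (fun p hp => (hmem p hp).1)
      (by
        intro p hp a
        have h0 := (hmem p hp).2
        have hA' : p.1 ∉ A ++ [q.1] := by
          rw [← List.count_eq_zero, List.count_append] at h0 ⊢
          rwa [← hAb]
        have := hbef p (List.mem_cons_of_mem _ hp) a
        rw [hv, toList_assemble_cons, List.append_cons, List.append_cons (FreeMonoid.toList b0),
          countBefore_append h0,
          countBefore_append hA', List.count_append, List.count_append, hAb] at this
        rw [FreeMonoid.toList_ofList]
        omega)
    refine ⟨FreeMonoid.ofList A, (q.1, c1) :: vrest, ?_, hAb, .cons ⟨rfl, hc1⟩ hF⟩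
    apply FreeMonoid.toList.injective
    rw [hv, toList_assemble_cons, ← hB]
    simp

lemma mem_takeWhile_of_countBefore_lt {w : List ℕ} {a p q : ℕ}
    (h : countBefore w a p < countBefore w a q) : p ∈ w.takeWhile (fun b => b ≠ q) := by
  by_contra hp
  have hw := countBefore_append hp (w.dropWhile fun b => b ≠ q) a
  rw [List.takeWhile_append_dropWhile] at hw
  rw [hw, countBefore.eq_def w a q] at h
  omega

lemma countBefore_le_of_mem_takeWhile {w : List ℕ} {p q : ℕ}
    (h : p ∈ w.takeWhile (fun b => b ≠ q)) (a : ℕ) : countBefore w a p ≤ countBefore w a q := by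
  obtain ⟨C, E, hT, hC⟩ := List.eq_append_cons_of_mem h
  have hw := List.takeWhile_append_dropWhile (p := fun b => decide (b ≠ q)) (l := w)
  rw [hT, List.append_assoc, List.cons_append] at hw
  have h1 : countBefore w a q = (C ++ p :: E).count a := by rw [countBefore, hT]
  have h2 : countBefore w a p = C.count a := by rw [← hw, countBefore_append_cons_self hC]
  rw [h1, h2, List.count_append]
  omega

lemma countBefore_of_separators {θ : Con FM} (hθ : IsFullyInvariant θ) {n : ℕ} (hn : 1 ≤ n)
    (hiso : IsIsoterm θ (xtkWord n)) {u v : FM} (huv : θ u v) {a p : ℕ} {s : ℕ → ℕ}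
    (hc : occ u a = n + 1) (h1 : ∀ i < n, occ u (s i) = 1)
    (hb : ∀ i < n, countBefore (FreeMonoid.toList u) a (s i) = i + 1) (hp : occ u p = 1) :
    (∀ i < n, countBefore (FreeMonoid.toList u) a p = i + 1 →
      countBefore (FreeMonoid.toList v) a p = i + 1) ∧
    (countBefore (FreeMonoid.toList u) a p = 0 → countBefore (FreeMonoid.toList v) a p ≤ 1) := by
  constructor
  · intro i hi hpi
    have key := separated_letter_eq hθ hiso huv (p := Function.update s i p) hc
      (fun j hj => by
        by_cases h : j = i
        · subst h; simpa using hp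
        · simpa [h] using h1 j hj)
      (fun j hj => by
        by_cases h : j = i
        · subst h; simpa using hpi
        · simpa [h] using hb j hj)
    simpa using key.2 i hi
  · intro hp0
    have hs := (separated_letter_eq hθ hiso huv hc h1 hb).2 0 hn
    have hmem : p ∈ (FreeMonoid.toList u).takeWhile (fun b => b ≠ s 0) :=
      mem_takeWhile_of_countBefore_lt (a := a) (by rw [hp0, hb 0 hn]; omega)
    have hu : countBefore (FreeMonoid.toList u) p (s 0) = 1 := by
      have h2 := countBefore_le_count (FreeMonoid.toList u) p (s 0)
      rw [occ] at hp
      have h3 := List.count_pos_iff.2 hmem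
      rw [countBefore] at h2 ⊢
      omega
    have hv := simple_letter_before hθ (hiso.xtkWord_of_le hn) huv hp (h1 0 hn) hu
    have hmem' : p ∈ (FreeMonoid.toList v).takeWhile (fun b => b ≠ s 0) :=
      List.count_pos_iff.1 (Nat.one_pos.trans_eq hv.symm)
    have := countBefore_le_of_mem_takeWhile hmem' a
    omega

lemma countBefore_eq_of_separators {θ : Con FM} (hθ : IsFullyInvariant θ) {n : ℕ} (hn : 1 ≤ n)
    (hiso : IsIsoterm θ (xtkWord n)) {u v : FM} (huv : θ u v) {a p : ℕ} {s : ℕ → ℕ}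
    (hc : occ u a = n + 1) (h1 : ∀ i < n, occ u (s i) = 1) (h1' : ∀ i < n, occ v (s i) = 1)
    (hb : ∀ i < n, countBefore (FreeMonoid.toList u) a (s i) = i + 1)
    (hp : occ u p = 1) (hp' : occ v p = 1) :
    countBefore (FreeMonoid.toList v) a p = countBefore (FreeMonoid.toList u) a p := by
  obtain ⟨hcv, hbv⟩ := separated_letter_eq hθ hiso huv hc h1 hb
  obtain ⟨hu1, hu0⟩ := countBefore_of_separators hθ hn hiso huv hc h1 hb hp
  obtain ⟨hv1, hv0⟩ := countBefore_of_separators hθ hn hiso (θ.symm huv) hcv h1' hbv hp'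
  have hu := countBefore_le_count (FreeMonoid.toList u) a p
  have hv := countBefore_le_count (FreeMonoid.toList v) a p
  rw [occ] at hc hcv
  rw [hc] at hu
  rw [hcv] at hv
  generalize countBefore (FreeMonoid.toList u) a p = U at *
  generalize countBefore (FreeMonoid.toList v) a p = V at *
  have hu1 := hu1 (U - 1)
  have hv1 := hv1 (V - 1)
  omega

/-- **Lemma 3.1.** If the word `x t₁ x ⋯ t_k x` is an isoterm for `θ`, and `u` is a
word all of whose blocks are linear and in which every letter occurs at most `k+1`
times, then every identity `(u, v) ∈ θ` is linear-balanced. -/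
theorem lemma_3_1 (θ : Con FM) (hθ : IsFullyInvariant θ)
    (k : ℕ) (hk : 1 ≤ k) (hiso : IsIsoterm θ (xtkWord k))
    (u : FM)
    (hblocks : ∃ (b0 : FM) (rest : List (ℕ × FM)),
        IsDecomposition u b0 rest ∧ LinearW b0 ∧ ∀ p ∈ rest, LinearW p.2)
    (hocc : ∀ a : ℕ, occ u a ≤ k + 1)
    (v : FM) (huv : θ u v) :
    LinearBalanced u v := by
  obtain ⟨b0, rest, hdec, hlin0, hlin⟩ := hblocks
  obtain ⟨hu, hsimp, hm0, hm⟩ := hdec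
  have hone : ∀ a, occ u a = 1 → occ v a = 1 := fun a ha =>
    (separated_letter_eq (p := id) hθ (hiso.xtkWord_of_le k.zero_le) huv ha (by simp)
      (by simp)).1
  have hsep : ∀ a n, 1 ≤ n → occ u a = n + 1 → ∃ s : ℕ → ℕ, ∀ i < n, occ u (s i) = 1 ∧
      countBefore (FreeMonoid.toList u) a (s i) = i + 1 := by
    intro a n hn ha
    have h : ∀ i, ∃ c, i < n → occ u c = 1 ∧ countBefore (FreeMonoid.toList u) a c = i + 1 := by
      intro i
      by_cases hi : i < n
      · obtain ⟨p, hp, hpi⟩ := exists_separator (a := a) rest b0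
          (fun p hp e => by have := hsimp p hp; rw [e] at this; omega)
          (fun p hp => hlin p hp a) (fun p hp => hu ▸ hsimp p hp) (i + 1)
          (by have : occ b0 a ≤ 1 := hlin0 a; omega) (hu ▸ (by omega : i + 1 < occ u a))
        exact ⟨p.1, fun _ => ⟨hsimp p hp, hu ▸ hpi⟩⟩
      · exact ⟨0, fun h => absurd h hi⟩
    choose s hs using h
    exact ⟨s, hs⟩
  have hoccv : ∀ a, occ v a = occ u a := by
    intro a
    rcases Nat.lt_trichotomy (occ u a) 1 with h | h | h
    · rw [occ_eq_zero_of_isoterm hθ hiso huv (a := a) (by omega)]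
      omega
    · rw [hone a h, h]
    · obtain ⟨n, hn⟩ : ∃ n, occ u a = n + 1 := ⟨occ u a - 1, by omega⟩
      obtain ⟨s, hs⟩ := hsep a n (by omega) hn
      have := hocc a
      rw [hn, (separated_letter_eq hθ (hiso.xtkWord_of_le (by omega)) huv hn
        (fun i hi => (hs i hi).1) (fun i hi => (hs i hi).2)).1]
  have hbef : ∀ p, occ u p = 1 → ∀ a, countBefore (FreeMonoid.toList v) a p =
      countBefore (FreeMonoid.toList u) a p := by
    intro p hp a
    have hbu := countBefore_le_count (FreeMonoid.toList u) a p
    have hbv := countBefore_le_count (FreeMonoid.toList v) a p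
    have ha := hoccv a
    have hk' := hocc a
    rcases Nat.lt_trichotomy (occ u a) 1 with h | h | h
    · rw [occ] at h ha
      rw [occ] at ha
      omega
    · have h2 := simple_letter_before hθ (hiso.xtkWord_of_le hk) huv h hp
      have h3 := simple_letter_before hθ (hiso.xtkWord_of_le hk) (θ.symm huv) (hone a h)
        (hone p hp)
      rw [occ] at h ha
      rw [occ] at ha
      omega
    · obtain ⟨n, hn⟩ : ∃ n, occ u a = n + 1 := ⟨occ u a - 1, by omega⟩
      obtain ⟨s, hs⟩ := hsep a n (by omega) hn
      exact countBefore_eq_of_separators hθ (by omega) (hiso.xtkWord_of_le (by omega)) huv hn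
        (fun i hi => (hs i hi).1) (fun i hi => hone _ (hs i hi).1) (fun i hi => (hs i hi).2) hp
        (hone p hp)
  obtain ⟨c0, vrest, hv, hc0, hF⟩ := exists_parallel_assemble rest b0 v
    (fun a => hu ▸ hoccv a) (fun p hp => hu ▸ hsimp p hp)
    (fun p hp a => hu ▸ hbef p.1 (hsimp p hp) a)
  have hpair : ∀ q ∈ vrest, ∃ p ∈ rest, p.1 = q.1 ∧ ∀ a, occ p.2 a = occ q.2 a := by
    intro q hq
    obtain ⟨hlen, hget⟩ := List.forall₂_iff_get.1 hF
    obtain ⟨i, hi, rfl⟩ := List.getElem_of_mem hq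
    exact ⟨rest[i], List.getElem_mem _, hget i (hlen ▸ hi) hi⟩
  refine ⟨b0, c0, rest, vrest, ⟨hu, hsimp, hm0, hm⟩, ⟨hv, ?_, ?_, ?_⟩, ?_, ?_⟩
  · intro q hq
    obtain ⟨p, hp, hpq, -⟩ := hpair q hq
    rw [← hpq]
    exact hone _ (hsimp p hp)
  · intro a ha
    rw [hoccv]
    refine hm0 a (List.count_pos_iff.1 ?_)
    have := hc0 a
    rw [occ, occ] at this
    rw [this]
    exact List.count_pos_iff.2 ha
  · intro q hq a ha
    obtain ⟨p, hp, -, hpq⟩ := hpair q hq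
    rw [hoccv]
    refine hm p hp a (List.count_pos_iff.1 ?_)
    have := hpq a
    rw [occ, occ] at this
    rw [this]
    exact List.count_pos_iff.2 ha
  · clear * - hF
    induction hF with
    | nil => rfl
    | cons h _ ih => simp [h.1, ih]
  · intro a _
    refine ⟨hc0 a, hlin0 a, fun q hq => ⟨?_, hlin _ (List.of_mem_zip hq).1 a⟩⟩
    exact (List.forall₂_zip hF hq).2 a
end

section
/- Corollary 3.4: Let θ_A = θ({x² ≈ x³, x²y ≈ yx²}) and let θ_X, θ_Y be fully invariant congruences on F = FreeMonoid ℕ with θ_A ⊆ θ_X and θ_A ⊆ θ_Y (the corresponding varieties X and Y are subvarieties of A). If, for some k ≥ 2, the pair (x t₁ x t₂ x ⋯ t_k x, x² t₁ t₂ ⋯ t_k) (the identity δ_k, over pairwise distinct letters x, t₁, …, t_k) belongs to θ_X ⊔ θ_Y, then it belongs to θ_X or to θ_Y. -/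
/-- The equational theory of `A`. -/
def θA : Con FM := fiCon {(xL ^ 2, xL ^ 3), (xL ^ 2 * yL, yL * xL ^ 2)}
/-- The left-hand side `x t₁ x t₂ x ⋯ t_k x` of the identity `δ_k`. -/
def deltaLhs (k : ℕ) : FM := xL * prodRange k (fun i => tV i * xL)
/-- The right-hand side `x² t₁ t₂ ⋯ t_k` of the identity `δ_k`. -/
def deltaRhs (k : ℕ) : FM := xL ^ 2 * prodRange k (fun i => tV i)

section Monoid

variable {M : Type*} [Monoid M]

/-- The product `x ^ e 0 * t 0 * x ^ e 1 * t 1 * ⋯ * t (k - 1) * x ^ e k`. -/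
def interleave (x : M) (t : ℕ → M) (e : ℕ → ℕ) : ℕ → M
  | 0 => x ^ e 0
  | k + 1 => interleave x t e k * (t k * x ^ e (k + 1))

lemma map_interleave {N : Type*} [Monoid N] (φ : M →* N) (x : M) (t : ℕ → M) (e : ℕ → ℕ)
    (k : ℕ) : φ (interleave x t e k) = interleave (φ x) (fun i => φ (t i)) e k := by
  induction k with
  | zero => simp [interleave]
  | succ k ih => simp [interleave, ih]

lemma interleave_congr (x : M) (t : ℕ → M) {e e' : ℕ → ℕ} {k : ℕ} (h : ∀ i ≤ k, e i = e' i) :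
    interleave x t e k = interleave x t e' k := by
  induction k with
  | zero => simp [interleave, h]
  | succ k ih => simp [interleave, h, ih fun i hi => h i (by omega)]

lemma pow_mul_interleave (x : M) (t : ℕ → M) (c e : ℕ → ℕ) (k : ℕ) :
    x ^ c 0 * interleave x (fun i => t i * x ^ c (i + 1)) e k =
      interleave x t (fun i => c i + e i) k := by
  induction k with
  | zero => simp [interleave, pow_add]
  | succ k ih => simp only [interleave, ← mul_assoc, ih, pow_add]

lemma interleave_one_of_comm (hc : ∀ a b : M, a * b = b * a) (x : M) (t : ℕ → M) (k : ℕ) :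
    interleave x t (fun _ => 1) k = x ^ (k + 1) * interleave x t (fun _ => 0) k := by
  induction k with
  | zero => simp [interleave]
  | succ k ih =>
    simp only [interleave, ih, pow_one, pow_zero, mul_one]
    rw [pow_succ x (k + 1), hc (t k) x, mul_assoc, mul_assoc,
      ← mul_assoc _ x, hc (interleave _ _ _ _) x, mul_assoc]

lemma pow_eq_sq (h : ∀ a : M, a ^ 2 = a ^ 3) (a : M) {n : ℕ} (hn : 2 ≤ n) : a ^ n = a ^ 2 := by
  induction n, hn using Nat.le_induction with
  | base => rfl
  | succ n _ ih => rw [pow_succ, ih, ← pow_succ, ← h]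

lemma sq_mul_interleave (h3 : ∀ a : M, a ^ 2 = a ^ 3) (hc : ∀ a b : M, a ^ 2 * b = b * a ^ 2)
    (x : M) (t : ℕ → M) (e : ℕ → ℕ) (k : ℕ) :
    x ^ 2 * interleave x t e k = x ^ 2 * interleave x t (fun _ => 0) k := by
  induction k with
  | zero => simp [interleave, ← pow_add, pow_eq_sq h3]
  | succ k ih =>
    have hx : ∀ n, x ^ 2 * x ^ n = x ^ 2 := fun n => by
      rw [← pow_add, pow_eq_sq h3 x (by omega)]
    simp only [interleave, pow_zero, mul_one]
    rw [← mul_assoc, ih, ← mul_assoc, mul_assoc (x ^ 2), hc, mul_assoc, hx, ← hc]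

lemma sq_mul_interleave_eq_self (h3 : ∀ a : M, a ^ 2 = a ^ 3)
    (hc : ∀ a b : M, a ^ 2 * b = b * a ^ 2) (x : M) (t : ℕ → M) (e : ℕ → ℕ) {j k : ℕ}
    (hj : j ≤ k) (he : 2 ≤ e j) : x ^ 2 * interleave x t e k = interleave x t e k := by
  have hx : x ^ 2 * x ^ e j = x ^ e j := by
    rw [← pow_add, pow_eq_sq h3 x (by omega), pow_eq_sq h3 x he]
  induction k, hj using Nat.le_induction with
  | base =>
    cases j with
    | zero => exact hx
    | succ j =>
      simp only [interleave]
      rw [hc, mul_assoc, mul_assoc, ← hc, hx]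
  | succ k _ ih => rw [interleave, ← mul_assoc, ih]

lemma eq_sq_of_pow_eq (h3 : ∀ a : M, a ^ 2 = a ^ 3) {i j : ℕ} (hi : i ≤ 1) (hij : i ≠ j) {a : M}
    (h : a ^ i = a ^ j) : a = a ^ 2 := by
  have hi' : i = 0 ∨ i = 1 := by omega
  rcases hi' with rfl | rfl
  · have h2 : (1 : M) = a ^ 2 := by
      rw [← pow_eq_sq h3 a (n := j * 2) (by omega), pow_mul, ← h]; simp
    calc a = a * 1 := by simp
      _ = a ^ 2 := by rw [h2, ← pow_succ', ← h3]
  · rcases j with _ | _ | j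
    · simp_all
    · omega
    · rwa [pow_one, pow_eq_sq h3 a (by omega)] at h

lemma prod_map_filter_of_eq_one {α : Type*} (p : α → Bool) (f : α → M)
    (hf : ∀ a, p a = false → f a = 1) (l : List α) :
    ((l.filter p).map f).prod = (l.map f).prod := by
  induction l with
  | nil => rfl
  | cons a l ih =>
    cases hp : p a <;> simp [hp, ih, hf]

lemma prod_map_ite_eq_pow_count (n : ℕ) (a : M) (l : List ℕ) :
    (l.map (fun m => if m = n then a else 1)).prod = a ^ l.count n := by
  induction l with
  | nil => simp
  | cons b l ih =>
    by_cases hb : b = n <;> simp [hb, ih, pow_succ']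

/-- A nontrivial identity whose left side is linear forces commutativity. -/
lemma comm_of_linear_identity (h3 : ∀ a : M, a ^ 2 = a ^ 3)
    (hc : ∀ a b : M, a ^ 2 * b = b * a ^ 2) {L l : List ℕ} (hL : L.Pairwise (· < ·))
    (hne : l ≠ L) (h : ∀ f : ℕ → M, (L.map f).prod = (l.map f).prod) (x y : M) :
    x * y = y * x := by
  have hLn : L.Nodup := hL.imp fun hab => hab.ne
  by_cases hp : L.Perm l
  · have hln : l.Nodup := hp.nodup_iff.1 hLn
    have hns : ¬ l.Pairwise (· < ·) := fun hl =>
      hne (hp.symm.eq_of_pairwise (fun _ _ _ _ h1 h2 => (lt_asymm h1 h2).elim) hl hL)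
    rw [List.pairwise_iff_forall_sublist] at hns
    push Not at hns
    obtain ⟨b, a, hs, hba⟩ := hns
    have hab : a ≠ b := by
      have := hln.sublist hs
      simp at this
      exact Ne.symm this
    have hlt : a < b := by omega
    let p : ℕ → Bool := fun n => decide (n = a ∨ n = b)
    have hl2 : l.filter p = [b, a] := by
      have h1 : [b, a].Sublist (l.filter p) := by simpa [p] using hs.filter p
      refine (h1.eq_of_length_le ?_).symm
      refine ((hln.filter p).subperm ?_).length_le
      intro n hn
      simp [p] at hn
      simp; tauto
    have hL2 : L.filter p = [a, b] := by
      have h1 : (L.filter p).Perm [a, b] :=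
        ((hp.filter p).trans (by rw [hl2])).trans (List.Perm.swap a b [])
      exact h1.eq_of_pairwise (fun _ _ _ _ h1 h2 => (lt_asymm h1 h2).elim) (hL.filter p)
        (by simpa using hlt)
    let f : ℕ → M := fun n => if n = a then x else if n = b then y else 1
    have hf : ∀ n, p n = false → f n = 1 := by
      intro n hn
      simp [p] at hn
      simp [f, hn]
    have := h f
    rw [← prod_map_filter_of_eq_one p f hf L, ← prod_map_filter_of_eq_one p f hf l, hl2, hL2] at this
    simpa [f, hab.symm] using this
  · rw [List.perm_iff_count] at hp
    push Not at hp
    obtain ⟨n, hn⟩ := hp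
    have hsq : ∀ a : M, a = a ^ 2 := fun a => by
      refine eq_sq_of_pow_eq h3 (List.nodup_iff_count_le_one.1 hLn n) hn ?_
      simpa [prod_map_ite_eq_pow_count] using h fun m => if m = n then a else 1
    rw [hsq x, hc]

end Monoid

lemma prodRange_succ (k : ℕ) (f : ℕ → FM) : prodRange (k + 1) f = prodRange k f * f k := by
  simp [prodRange, List.range_succ]

lemma deltaLhs_eq (k : ℕ) : deltaLhs k = interleave xL tV (fun _ => 1) k := by
  induction k with
  | zero => simp [deltaLhs, prodRange, interleave]
  | succ k ih => rw [interleave, ← ih]; simp [deltaLhs, prodRange_succ, mul_assoc]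

lemma deltaRhs_eq (k : ℕ) : deltaRhs k = xL ^ 2 * interleave xL tV (fun _ => 0) k := by
  rw [deltaRhs]
  congr 1
  induction k with
  | zero => simp [prodRange, interleave]
  | succ k ih => rw [interleave, ← ih]; simp [prodRange_succ]

lemma deltaLhs_ne_deltaRhs {k : ℕ} (hk : 2 ≤ k) : deltaLhs k ≠ deltaRhs k := by
  intro h
  have h' := congrArg (FreeMonoid.lift fun n => if n = 0 then Multiplicative.ofAdd 1
    else (1 : Multiplicative ℕ)) h
  rw [deltaLhs_eq, deltaRhs_eq, map_mul, map_interleave, map_interleave,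
    interleave_one_of_comm mul_comm] at h'
  have h2 := congrArg Multiplicative.toAdd (mul_right_cancel h')
  simp [xL] at h2
  omega

/-- The indexing letters `t₀, …, t_{k-1}` as a list. -/
def tLetters (k : ℕ) : List ℕ := (List.range k).map fun i => 11 + 2 * i

lemma tLetters_succ (k : ℕ) : tLetters (k + 1) = tLetters k ++ [11 + 2 * k] := by
  simp [tLetters, List.range_succ]

lemma tLetters_pairwise (k : ℕ) : (tLetters k).Pairwise (· < ·) := by
  rw [tLetters, List.pairwise_map]
  exact List.pairwise_lt_range.imp fun h => by omega

lemma filter_deltaLhs (k : ℕ) :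
    (FreeMonoid.toList (deltaLhs k)).filter (fun n => decide (n ≠ 0)) = tLetters k := by
  rw [deltaLhs_eq]
  induction k with
  | zero => simp [interleave, tLetters, xL]
  | succ k ih =>
    rw [interleave, tLetters_succ, ← ih]
    simp [xL, tV]

lemma exists_eq_pow_of_filter_eq_nil {l : List ℕ}
    (h : l.filter (fun n => decide (n ≠ 0)) = []) : ∃ n, FreeMonoid.ofList l = xL ^ n := by
  induction l with
  | nil => exact ⟨0, rfl⟩
  | cons a l ih =>
    by_cases ha : a = 0
    · obtain ⟨n, hn⟩ := ih (by simpa [ha] using h)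
      exact ⟨n + 1, by rw [FreeMonoid.ofList_cons, hn, pow_succ', ha, xL]⟩
    · simp [ha] at h

lemma exists_eq_interleave {k : ℕ} {l : List ℕ}
    (h : l.filter (fun n => decide (n ≠ 0)) = tLetters k) :
    ∃ e, FreeMonoid.ofList l = interleave xL tV e k := by
  induction k generalizing l with
  | zero =>
    obtain ⟨n, hn⟩ := exists_eq_pow_of_filter_eq_nil h
    exact ⟨fun _ => n, hn⟩
  | succ k ih =>
    rw [tLetters_succ, List.filter_eq_append_iff] at h
    obtain ⟨l₁, l₂, rfl, h₁, h₂⟩ := h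
    rw [List.filter_eq_cons_iff] at h₂
    obtain ⟨l₃, l₄, rfl, h₃, -, h₄⟩ := h₂
    obtain ⟨e, he⟩ := ih (l := l₁ ++ l₃) (by
      rw [List.filter_append, h₁, List.filter_eq_nil_iff.2 h₃, List.append_nil])
    obtain ⟨n, hn⟩ := exists_eq_pow_of_filter_eq_nil h₄
    refine ⟨Function.update e (k + 1) n, ?_⟩
    rw [interleave, interleave_congr xL tV (e' := e)
      (fun i hi => Function.update_of_ne (by omega) _ _), ← he, Function.update_self, ← hn, tV]
    simp [FreeMonoid.ofList_append, FreeMonoid.ofList_cons, mul_assoc]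

/-- In monoids with `x² ≈ x³` and central squares, every nontrivial identity with left side
`x t₁ x ⋯ t_k x` implies `δ_k`. -/
lemma msatisfies_delta {M : Type*} [Monoid M] (h3 : ∀ a : M, a ^ 2 = a ^ 3)
    (hc : ∀ a b : M, a ^ 2 * b = b * a ^ 2) {k : ℕ} (hk : 1 ≤ k) {v : FM} (hv : v ≠ deltaLhs k)
    (h : MSatisfies M (deltaLhs k, v)) : MSatisfies M (deltaLhs k, deltaRhs k) := by
  intro φ
  by_cases hl : (FreeMonoid.toList v).filter (fun n => decide (n ≠ 0)) = tLetters k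
  · obtain ⟨e, he⟩ := exists_eq_interleave hl
    rw [FreeMonoid.ofList_toList] at he
    subst he
    dsimp only
    have key : ∀ e' : ℕ → ℕ, (∃ j ≤ k, 2 ≤ e' j) →
        φ (interleave xL tV e' k) = φ (deltaRhs k) := by
      rintro e' ⟨j, hj, hj2⟩
      rw [deltaRhs_eq, map_mul, map_pow, map_interleave, map_interleave,
        ← sq_mul_interleave h3 hc _ _ e', sq_mul_interleave_eq_self h3 hc _ _ _ hj hj2]
    by_cases h2 : ∃ j ≤ k, 2 ≤ e j
    · exact (h φ).trans (key e h2)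
    · push Not at h2
      -- Refill the missing occurrences of `x`: the right side becomes `x t₁ x ⋯ t_k x`,
      -- while the left side acquires a factor `x²`.
      let c : ℕ → ℕ := fun i => 1 - e i
      let ψ : FM →* M := FreeMonoid.lift fun n =>
        if n = 0 then φ xL else φ (FreeMonoid.of n) * φ xL ^ c ((n - 11) / 2 + 1)
      have hψx : ψ xL = φ xL := by simp [ψ, xL]
      have hψt : ∀ i, ψ (tV i) = φ (tV i) * φ xL ^ c (i + 1) := by
        intro i
        simp [ψ, tV]
      have hrefill : ∀ e' : ℕ → ℕ, φ xL ^ c 0 * ψ (interleave xL tV e' k) =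
          φ (interleave xL tV (fun i => c i + e' i) k) := by
        intro e'
        rw [map_interleave, map_interleave, ← pow_mul_interleave, hψx]
        simp only [hψt]
      have hψ : ψ (deltaLhs k) = ψ (interleave xL tV e k) := h ψ
      have hmiss : ∃ j ≤ k, e j ≠ 1 := by
        by_contra! hall
        exact hv ((interleave_congr xL tV hall).trans (deltaLhs_eq k).symm)
      obtain ⟨j, hj, hj1⟩ := hmiss
      calc φ (deltaLhs k) = φ (interleave xL tV (fun i => c i + e i) k) := by
            rw [deltaLhs_eq]
            congr 1
            refine interleave_congr xL tV fun i hi => ?_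
            have := h2 i hi
            simp only [c]
            omega
        _ = φ (interleave xL tV (fun i => c i + 1) k) := by
            rw [← hrefill, ← hψ, deltaLhs_eq, hrefill]
        _ = φ (deltaRhs k) := by
            refine key _ ⟨j, hj, ?_⟩
            have := h2 j hj
            simp only [c]
            omega
  · have hcomm : ∀ a b : M, a * b = b * a := by
      refine comm_of_linear_identity h3 hc (tLetters_pairwise k) hl fun f => ?_
      have hf := h (FreeMonoid.lift fun n => if n = 0 then 1 else f n)
      have hfilter : ∀ l : List ℕ, ((l.filter fun n => decide (n ≠ 0)).map f).prod =
          (l.map fun n => if n = 0 then 1 else f n).prod := by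
        intro l
        rw [← prod_map_filter_of_eq_one (fun n => decide (n ≠ 0))
          (fun n => if n = 0 then 1 else f n) (by simp)]
        congr 1
        refine List.map_congr_left fun n hn => ?_
        have : n ≠ 0 := by simpa using (List.mem_filter.1 hn).2
        simp [this]
      rw [← filter_deltaLhs, hfilter, hfilter]
      simpa only [FreeMonoid.lift_apply] using hf
    dsimp only
    rw [deltaLhs_eq, deltaRhs_eq, map_mul, map_pow, map_interleave, map_interleave,
      interleave_one_of_comm hcomm, pow_eq_sq h3 _ (by omega)]

lemma IsFullyInvariant.satisfiesAll {θ : Con FM} (hθ : IsFullyInvariant θ) :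
    SatisfiesAll θ θ.Quotient := by
  intro u v huv φ
  choose g hg using fun n => Con.mk'_surjective (c := θ) (φ (FreeMonoid.of n))
  have hφ : φ = θ.mk'.comp (FreeMonoid.lift g) := FreeMonoid.hom_eq fun n => by
    simpa using (hg n).symm
  rw [hφ]
  exact (Con.eq θ).2 (hθ _ u v huv)

lemma θA_of_mem {p : FM × FM}
    (hp : p ∈ ({(xL ^ 2, xL ^ 3), (xL ^ 2 * yL, yL * xL ^ 2)} : Set (FM × FM))) :
    θA p.1 p.2 := by
  intro c hc
  exact hc.2 p hp

lemma sq_eq_cube_of_msatisfies {M : Type*} [Monoid M] (h : MSatisfies M (xL ^ 2, xL ^ 3))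
    (a : M) : a ^ 2 = a ^ 3 := by
  simpa [xL] using h (FreeMonoid.lift fun _ => a)

lemma sq_mul_comm_of_msatisfies {M : Type*} [Monoid M]
    (h : MSatisfies M (xL ^ 2 * yL, yL * xL ^ 2)) (a b : M) : a ^ 2 * b = b * a ^ 2 := by
  simpa [xL, yL] using h (FreeMonoid.lift fun n => if n = 0 then a else b)

lemma isIsoterm_deltaLhs {θ : Con FM} (hθ : IsFullyInvariant θ) (hA : θA ≤ θ) {k : ℕ}
    (hk : 1 ≤ k) (h : ¬ θ (deltaLhs k) (deltaRhs k)) : IsIsoterm θ (deltaLhs k) := by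
  intro v hv
  by_contra hne
  have h3 := sq_eq_cube_of_msatisfies (hθ.satisfiesAll _ _
    (hA (θA_of_mem (p := (xL ^ 2, xL ^ 3)) (by simp))))
  have hc := sq_mul_comm_of_msatisfies (hθ.satisfiesAll _ _
    (hA (θA_of_mem (p := (xL ^ 2 * yL, yL * xL ^ 2)) (by simp))))
  exact h ((Con.eq θ).1
    (msatisfies_delta h3 hc hk hne (hθ.satisfiesAll _ _ hv) θ.mk'))

/-- The syntactic congruence of the singleton language `{w}`. -/
def syntacticCon (w : FM) : Con FM where
  r u v := ∀ a b : FM, a * u * b = w ↔ a * v * b = w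
  iseqv := ⟨fun _ _ _ => Iff.rfl, fun h a b => (h a b).symm,
    fun h h' a b => (h a b).trans (h' a b)⟩
  mul' := by
    intro u v u' v' h h' a b
    have h₁ := h a (u' * b)
    have h₂ := h' (a * v) b
    simp only [mul_assoc] at h₁ h₂ ⊢
    exact h₁.trans h₂

lemma IsIsoterm.le_syntacticCon {θ : Con FM} {w : FM} (h : IsIsoterm θ w) :
    θ ≤ syntacticCon w := by
  intro u v huv a b
  have hab : θ (a * u * b) (a * v * b) := θ.mul (θ.mul (θ.refl a) huv) (θ.refl b)
  exact ⟨fun hw => h _ (hw ▸ hab), fun hw => h _ (hw ▸ θ.symm hab)⟩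

lemma IsIsoterm.sup {θ θ' : Con FM} {w : FM} (h : IsIsoterm θ w) (h' : IsIsoterm θ' w) :
    IsIsoterm (θ ⊔ θ') w := by
  intro v hv
  have : syntacticCon w w v := sup_le h.le_syntacticCon h'.le_syntacticCon hv
  simpa using (this 1 1).1 (by simp)

/-- **Corollary 3.4.** If two subvarieties of `A` are such that their meet satisfies
`δ_k` (`k ≥ 2`), then `δ_k` holds in one of them. -/
theorem cor_3_4 (θX θY : Con FM)
    (hfiX : IsFullyInvariant θX) (hfiY : IsFullyInvariant θY)
    (hAX : θA ≤ θX) (hAY : θA ≤ θY)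
    (k : ℕ) (hk : 2 ≤ k)
    (h : (θX ⊔ θY) (deltaLhs k) (deltaRhs k)) :
    θX (deltaLhs k) (deltaRhs k) ∨ θY (deltaLhs k) (deltaRhs k) := by
  by_contra! hn
  have hk1 : 1 ≤ k := by omega
  exact deltaLhs_ne_deltaRhs hk (((isIsoterm_deltaLhs hfiX hAX hk1 hn.1).sup
    (isIsoterm_deltaLhs hfiY hAY hk1 hn.2)) _ h).symm
end

section
/- Lemma 3.5: Let θ be a fully invariant congruence on F = FreeMonoid ℕ with θ_A ⊆ θ, where θ_A = θ({x² ≈ x³, x²y ≈ yx²}) (the corresponding variety V is a subvariety of A). Let k, ℓ ≥ 0, let a₁, …, a_{k+ℓ} ∈ {x, y} be letters such that both x and y occur among a₁, …, a_{k+ℓ}, let t₁, …, t_{k+ℓ} be pairwise distinct letters different from x and y, and set p = a₁t₁a₂t₂⋯a_k t_k and q = t_{k+1}a_{k+1}t_{k+2}a_{k+2}⋯t_{k+ℓ}a_{k+ℓ}. If there exists (u, v) ∈ θ such that the monoid S(p·x·y·q) does not satisfy the identity u ≈ v (i.e. S(pxyq) does not lie in V), then (p·x·y·q, p·y·x·q)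 ∈ θ, i.e. V satisfies the identity pxyq ≈ pyxq. -/
/-- Squares in `M` are central and idempotent: `M` satisfies `x² ≈ x³` and `x²y ≈ yx²`. -/
def SqCentral (M : Type*) [Monoid M] : Prop :=
  ∀ x : M, x ^ 3 = x ^ 2 ∧ ∀ y : M, x ^ 2 * y = y * x ^ 2

/-- `M` satisfies the identity `u ≈ v` between words given as lists of letters. -/
def Sat (M : Type*) [Monoid M] (u v : List ℕ) : Prop :=
  ∀ φ : ℕ → M, (u.map φ).prod = (v.map φ).prod

/-- The product `X ^ e₀ * g₀ * X ^ e₁ * g₁ * ⋯`. -/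
def powerProd {M : Type*} [Monoid M] (X : M) (es : List ℕ) (gs : List M) : M :=
  (List.zipWith (fun e g => X ^ e * g) es gs).prod

/-- `M` satisfies the identity `x^{e₀}t₀x^{e₁}t₁⋯ ≈ x^{f₀}t₀x^{f₁}t₁⋯`. -/
def Agree (M : Type*) [Monoid M] (es fs : List ℕ) : Prop :=
  es.length = fs.length ∧
    ∀ (X : M) (gs : List M), gs.length = es.length → powerProd X es gs = powerProd X fs gs

/-- `M` satisfies the identity `x^{e₀}t₀x^{e₁}t₁⋯ ≈ x²t₀t₁⋯`. -/
def Collapse (M : Type*) [Monoid M] (es : List ℕ) : Prop :=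
  ∀ (X : M) (gs : List M), gs.length = es.length → powerProd X es gs = X ^ 2 * gs.prod

/-- The word `b₀t₀b₁t₁⋯` with blocks `bᵢ` and letters `tᵢ`. -/
def blockWord (bs : List (List ℕ)) (ts : List ℕ) : List ℕ :=
  (List.zipWith (fun b t => b ++ [t]) bs ts).flatten

lemma exists_map_eq {M : Type*} (φ₀ : ℕ → M) (ts : List ℕ) (hts : ts.Nodup) (gs : List M)
    (h : gs.length = ts.length) :
    ∃ φ : ℕ → M, ts.map φ = gs ∧ ∀ n, n ∉ ts → φ n = φ₀ n := by
  induction ts generalizing gs with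
  | nil => exact ⟨φ₀, by simp_all⟩
  | cons t ts ih =>
    obtain ⟨g, gs, rfl⟩ := List.exists_cons_of_length_eq_add_one h
    rw [List.nodup_cons] at hts
    obtain ⟨φ, h1, h2⟩ := ih hts.2 gs (by simpa using h)
    refine ⟨Function.update φ t g, ?_, fun n hn => ?_⟩
    · rw [List.map_cons, Function.update_self, ← h1]
      congr 1
      refine List.map_congr_left fun n hn => Function.update_of_ne ?_ _ _
      rintro rfl
      exact hts.1 hn
    · rw [List.mem_cons, not_or] at hn
      rw [Function.update_of_ne hn.1, h2 n hn.2]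

section SquareCentral

variable {M : Type*} [Monoid M]

lemma SqCentral.pow_add_two (hM : SqCentral M) (X : M) (n : ℕ) : X ^ (n + 2) = X ^ 2 := by
  induction n with
  | zero => rfl
  | succ n ih =>
    rw [show n + 1 + 2 = (n + 2) + 1 by omega, pow_succ, ih, ← pow_succ]
    exact (hM X).1

lemma SqCentral.comm_of_pow_eq (hM : SqCentral M) {i j : ℕ} (hi : i ≤ 1) (hij : i ≠ j)
    (h : ∀ X : M, X ^ i = X ^ j) (a b : M) : a * b = b * a := by
  have key : ∀ X : M, X = X ^ 2 := by
    intro X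
    obtain rfl | rfl : i = 0 ∨ i = 1 := by omega
    · obtain ⟨n, rfl⟩ : ∃ n, j = n + 1 := ⟨j - 1, by omega⟩
      rw [← hM.pow_add_two X n, pow_succ, ← h X, pow_zero, one_mul]
    · obtain rfl | ⟨n, rfl⟩ : j = 0 ∨ ∃ n, j = n + 2 := by
        rcases j with _ | _ | n
        · exact Or.inl rfl
        · exact absurd rfl hij
        · exact Or.inr ⟨n, rfl⟩
      · have hX := h X
        simp only [pow_one, pow_zero] at hX
        simp [hX]
      · rw [← hM.pow_add_two X n, ← h X, pow_one]
  rw [key a]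
  exact (hM a).2 b

@[simp] lemma powerProd_nil (X : M) (gs : List M) : powerProd X [] gs = 1 := by
  simp [powerProd]

@[simp] lemma powerProd_cons (X : M) (e : ℕ) (es : List ℕ) (g : M) (gs : List M) :
    powerProd X (e :: es) (g :: gs) = X ^ e * g * powerProd X es gs := by
  simp [powerProd]

lemma powerProd_append (X : M) (es fs : List ℕ) (gs hs : List M) (h : gs.length = es.length) :
    powerProd X (es ++ fs) (gs ++ hs) = powerProd X es gs * powerProd X fs hs := by
  simp [powerProd, List.zipWith_append h.symm]

lemma Agree.symm {es fs : List ℕ} (h : Agree M es fs) : Agree M fs es :=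
  ⟨h.1.symm, fun X gs hg => (h.2 X gs (hg.trans h.1.symm)).symm⟩

lemma Agree.collapse {es fs : List ℕ} (h : Agree M es fs) (hc : Collapse M es) :
    Collapse M fs := fun X gs hg => by
  rw [← h.2 X gs (hg.trans h.1.symm)]
  exact hc X gs (hg.trans h.1.symm)

lemma exists_append_cons_of_length {α : Type*} {gs : List α} {m n : ℕ}
    (h : gs.length = m + (n + 1)) :
    ∃ gp g gq, gs = gp ++ g :: gq ∧ gp.length = m ∧ gq.length = n := by
  have h2 : (gs.drop m).length = n + 1 := by simp [h]
  obtain ⟨g, gq, hg⟩ := List.exists_cons_of_length_eq_add_one h2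
  refine ⟨gs.take m, g, gq, ?_, by simp [h], ?_⟩
  · rw [← hg, List.take_append_drop]
  · rw [hg] at h2
    simpa using h2

lemma SqCentral.sq_mul_powerProd (hM : SqCentral M) (X : M) (es : List ℕ) (gs : List M)
    (h : gs.length = es.length) : X ^ 2 * powerProd X es gs = X ^ 2 * gs.prod := by
  induction es generalizing gs with
  | nil => simp_all
  | cons e es ih =>
    obtain ⟨g, gs, rfl⟩ := List.exists_cons_of_length_eq_add_one h
    have h' : gs.length = es.length := by simpa using h
    have hp : X ^ 2 * X ^ e = X ^ 2 := by
      rw [← pow_add, add_comm, hM.pow_add_two]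
    rw [powerProd_cons, List.prod_cons, ← mul_assoc, ← mul_assoc, hp, (hM X).2 g, mul_assoc,
      ih gs h', ← mul_assoc, ← (hM X).2 g, mul_assoc]

lemma SqCentral.collapse_of_two_le (hM : SqCentral M) {p s : List ℕ} {e : ℕ} (he : 2 ≤ e) :
    Collapse M (p ++ e :: s) := by
  intro X gs hg
  obtain ⟨gp, g, gq, rfl, hp, hq⟩ := exists_append_cons_of_length
    (m := p.length) (n := s.length) (by simpa using hg)
  have hX : X ^ e = X ^ 2 * X ^ e := by
    obtain ⟨n, rfl⟩ := Nat.exists_eq_add_of_le' he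
    rw [← pow_add, add_comm 2, hM.pow_add_two X (n + 2), hM.pow_add_two]
  rw [← hM.sq_mul_powerProd X _ _ hg, powerProd_append X _ _ _ _ hp, powerProd_cons,
    ← mul_assoc (X ^ 2), (hM X).2, mul_assoc _ (X ^ 2)]
  conv_lhs => rw [hX]
  simp only [mul_assoc]

lemma Collapse.insert (hM : SqCentral M) {p s : List ℕ} {n : ℕ} (hc : Collapse M (p ++ n :: s))
    (X : M) (gp : List M) (h g : M) (gq : List M) (hp : gp.length = p.length)
    (hq : gq.length = s.length) :
    powerProd X p gp * h * X ^ n * g * powerProd X s gq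
      = X ^ 2 * (gp.prod * h * g * gq.prod) := by
  rcases List.eq_nil_or_concat p with rfl | ⟨p, e, rfl⟩
  · obtain rfl : gp = [] := by simpa using hp
    have := hc X (g :: gq) (by simp [hq])
    simp only [List.nil_append, powerProd_cons, List.prod_cons] at this
    simp only [powerProd_nil, List.prod_nil, one_mul]
    rw [mul_assoc, mul_assoc, ← mul_assoc (X ^ n), this, ← mul_assoc, ← (hM X).2 h]
    simp only [mul_assoc]
  · rw [List.concat_eq_append] at hc hp ⊢
    obtain ⟨gp, c, gn, rfl, hp', hn⟩ := exists_append_cons_of_length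
      (gs := gp) (m := p.length) (n := 0) (by simpa using hp)
    obtain rfl : gn = [] := by simpa using hn
    have := hc X (gp ++ (c * h) :: g :: gq) (by simp [hq, hp'])
    rw [List.append_assoc, powerProd_append _ _ _ _ _ hp'] at this
    rw [powerProd_append _ _ _ _ _ hp']
    simp only [List.cons_append, List.nil_append, powerProd_cons, powerProd_nil, mul_one,
      List.prod_append, List.prod_cons, List.prod_nil, mul_assoc] at this ⊢
    exact this

lemma powerProd_replicate_one (X g : M) (c : List ℕ) (n : ℕ) (hn : c.length = n + 1) :
    powerProd X c (List.replicate n 1 ++ [g]) = X ^ c.sum * g := by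
  induction n generalizing c with
  | zero =>
    obtain ⟨a, rfl⟩ := List.length_eq_one_iff.1 hn
    simp
  | succ n ih =>
    obtain ⟨a, c, rfl⟩ := List.exists_cons_of_length_eq_add_one hn
    simp [List.replicate_succ, ih c (by simpa using hn), pow_add, mul_assoc]

lemma Agree.merge {p c s p' c' s' : List ℕ} (h : Agree M (p ++ c ++ s) (p' ++ c' ++ s'))
    (hp : p.length = p'.length) (hc : c.length = c'.length) (hc0 : c ≠ []) :
    Agree M (p ++ c.sum :: s) (p' ++ c'.sum :: s') := by
  have hlen := h.1
  simp only [List.length_append] at hlen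
  refine ⟨by simp; omega, fun X gs hg => ?_⟩
  obtain ⟨gp, g, gq, rfl, hgp, hgq⟩ := exists_append_cons_of_length
    (m := p.length) (n := s.length) (by simpa using hg)
  obtain ⟨n, hn⟩ : ∃ n, c.length = n + 1 :=
    Nat.exists_eq_succ_of_ne_zero (by simpa using hc0)
  have := h.2 X (gp ++ (List.replicate n 1 ++ [g]) ++ gq) (by simp [hgp, hgq, hn]; omega)
  rw [powerProd_append _ _ _ _ _ (by simp [hgp, hn]), powerProd_append _ _ _ _ _ hgp,
    powerProd_append _ _ _ _ _ (by simp [hgp, ← hc, hn, hp]),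
    powerProd_append _ _ _ _ _ (hgp.trans hp), powerProd_replicate_one _ _ _ _ hn,
    powerProd_replicate_one _ _ _ _ (hc ▸ hn)] at this
  rw [powerProd_append _ _ _ _ _ hgp, powerProd_append _ _ _ _ _ (hgp.trans hp)]
  simpa only [powerProd_cons, mul_assoc] using this

lemma exists_powerProd_eq (X : M) (c : List ℕ) (gs : List M) (h : gs.length = c.length)
    (hc : c.sum ≤ 1) :
    ∃ a b : M, a * b = gs.prod ∧ powerProd X c gs = a * X ^ c.sum * b := by
  induction c generalizing gs with
  | nil => exact ⟨1, 1, by simp_all⟩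
  | cons e c ih =>
    obtain ⟨g, gs, rfl⟩ := List.exists_cons_of_length_eq_add_one h
    rw [List.sum_cons] at hc
    obtain ⟨a, b, hab, hX⟩ := ih gs (by simpa using h) (by omega)
    obtain rfl | he : e = 0 ∨ e ≠ 0 := by omega
    · exact ⟨g * a, b, by simp [← hab, mul_assoc], by simp [hX, mul_assoc]⟩
    · obtain rfl : e = 1 := by omega
      have h0 : c.sum = 0 := by omega
      refine ⟨1, g * gs.prod, by simp, ?_⟩
      rw [powerProd_cons, hX, ← hab, List.sum_cons, h0]
      simp [mul_assoc]

lemma Collapse.expand (hM : SqCentral M) {p c s : List ℕ} (h : Collapse M (p ++ c.sum :: s))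
    (hc : c.sum ≤ 1) : Collapse M (p ++ c ++ s) := by
  intro X gs hg
  simp only [List.length_append] at hg
  obtain ⟨gp, gc, gq, rfl, hp, hc', hq⟩ : ∃ gp gc gq, gs = gp ++ gc ++ gq ∧
      gp.length = p.length ∧ gc.length = c.length ∧ gq.length = s.length :=
    ⟨gs.take p.length, (gs.drop p.length).take c.length, (gs.drop p.length).drop c.length,
      by rw [List.append_assoc, List.take_append_drop, List.take_append_drop],
      by simp; omega, by simp; omega, by simp; omega⟩
  obtain ⟨a, b, hab, hX⟩ := exists_powerProd_eq X c gc hc' hc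
  have := h.insert hM X gp a b gq hp hq
  rw [powerProd_append _ _ _ _ _ (by simp [hp, hc']), powerProd_append _ _ _ _ _ hp, hX,
    List.prod_append, List.prod_append, ← hab]
  simpa only [mul_assoc] using this

lemma exists_last_pos (p : List ℕ) (h : 1 ≤ p.sum) :
    ∃ s a z, p = s ++ a :: z ∧ 1 ≤ a ∧ z.sum = 0 := by
  induction p with
  | nil => simp at h
  | cons b p ih =>
    by_cases hp : 1 ≤ p.sum
    · obtain ⟨s, a, z, rfl, ha, hz⟩ := ih hp
      exact ⟨b :: s, a, z, rfl, ha, hz⟩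
    · rw [List.sum_cons] at h
      exact ⟨[], b, p, rfl, by omega, by omega⟩

lemma exists_first_pos (p : List ℕ) (h : 1 ≤ p.sum) :
    ∃ z a s, p = z ++ a :: s ∧ 1 ≤ a ∧ z.sum = 0 := by
  obtain ⟨s, a, z, hp, ha, hz⟩ := exists_last_pos p.reverse (by simpa using h)
  refine ⟨z.reverse, a, s.reverse, ?_, ha, by simpa using hz⟩
  rw [← List.reverse_reverse p, hp]
  simp

lemma exists_first_ne {α : Type*} (e f : List α) (hl : e.length = f.length) (h : e ≠ f) :
    ∃ p a b e' f', e = p ++ a :: e' ∧ f = p ++ b :: f' ∧ a ≠ b := by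
  induction e generalizing f with
  | nil => exact absurd (List.length_eq_zero_iff.1 hl.symm).symm h
  | cons a e ih =>
    obtain ⟨b, f, rfl⟩ := List.exists_cons_of_length_eq_add_one hl.symm
    by_cases hab : a = b
    · subst hab
      obtain ⟨p, c, d, e', f', rfl, rfl, hcd⟩ := ih f (by simpa using hl) (by simpa using h)
      exact ⟨a :: p, c, d, e', f', rfl, rfl, hcd⟩
    · exact ⟨[], a, b, e, f, rfl, rfl, hab⟩

lemma Agree.collapse_of_pos_prefix_zero (hM : SqCentral M) {p e f : List ℕ}
    (h : Agree M (p ++ 1 :: e) (p ++ 0 :: f)) (hp : ∀ n ∈ p, n ≤ 1) (hs : 1 ≤ p.sum) :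
    Collapse M (p ++ 1 :: e) := by
  obtain ⟨s, a, z, rfl, ha, hz⟩ := exists_last_pos p hs
  obtain rfl : a = 1 := le_antisymm (hp a (by simp)) ha
  have h' : Agree M (s ++ (1 :: z ++ [1]) ++ e) (s ++ (1 :: z ++ [0]) ++ f) := by
    simpa using h
  have hc := (h'.merge rfl (by simp) (by simp)).collapse
    (hM.collapse_of_two_le (by simp [hz]))
  simpa using h'.symm.collapse (hc.expand hM (by simp [hz]))

lemma Agree.collapse_of_pos_prefix (hM : SqCentral M) {p e f : List ℕ}
    (h : Agree M (p ++ e) (p ++ f)) (he : ∀ n ∈ p ++ e, n ≤ 1) (hf : ∀ n ∈ p ++ f, n ≤ 1)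
    (hs : 1 ≤ p.sum) (hne : e ≠ f) : Collapse M (p ++ e) := by
  obtain ⟨c, a, b, e, f, rfl, rfl, hab⟩ := exists_first_ne e f (by simpa using h.1) hne
  have ha := he a (by simp)
  have hb := hf b (by simp)
  have hpc : ∀ n ∈ p ++ c, n ≤ 1 := fun n hn => he n (by
    rw [← List.append_assoc]; exact List.mem_append_left _ hn)
  have hsum : 1 ≤ (p ++ c).sum := by rw [List.sum_append]; omega
  simp only [← List.append_assoc] at h ⊢
  obtain ⟨rfl, rfl⟩ | ⟨rfl, rfl⟩ : (a = 1 ∧ b = 0) ∨ (a = 0 ∧ b = 1) := by omega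
  · exact h.collapse_of_pos_prefix_zero hM hpc hsum
  · exact h.symm.collapse (h.symm.collapse_of_pos_prefix_zero hM hpc hsum)

lemma Agree.collapse_of_zero_prefix (hM : SqCentral M) {p e f : List ℕ}
    (h : Agree M (p ++ 1 :: e) (p ++ 0 :: f)) (he : ∀ n ∈ p ++ 1 :: e, n ≤ 1)
    (hf : ∀ n ∈ p ++ 0 :: f, n ≤ 1) (hes : 2 ≤ (p ++ 1 :: e).sum)
    (hfs : 2 ≤ (p ++ 0 :: f).sum) (hp : p.sum = 0) : Collapse M (p ++ 1 :: e) := by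
  simp only [List.sum_append, List.sum_cons, hp] at hes hfs
  obtain ⟨z, b, f, rfl, hb, hz⟩ := exists_first_pos f (by omega)
  obtain rfl : b = 1 := le_antisymm (hf b (by simp)) hb
  have hlen : e.length = z.length + 1 + f.length := by
    have := h.1
    simp at this
    omega
  obtain ⟨c, e, rfl, hc⟩ : ∃ c e', e = c ++ e' ∧ c.length = z.length + 1 :=
    ⟨e.take (z.length + 1), e.drop (z.length + 1), (List.take_append_drop _ _).symm,
      by simp; omega⟩
  have h' : Agree M (p ++ (1 :: c) ++ e) (p ++ (0 :: z ++ [1]) ++ f) := by simpa using h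
  have hm := h'.merge rfl (by simp [hc]) (by simp)
  rcases Nat.eq_zero_or_pos c.sum with hcs | hcs
  · by_cases hne : e = f
    · subst hne
      obtain ⟨y, d, s, rfl, hd, hy⟩ := exists_first_pos e (by
        simp only [List.sum_append] at hes
        omega)
      obtain rfl : d = 1 := le_antisymm (he d (by simp)) hd
      have h2 : Agree M ((p ++ [1]) ++ (c ++ y ++ [1]) ++ s)
          ((p ++ [0]) ++ (z ++ [1] ++ y ++ [1]) ++ s) := by simpa using h
      have hm2 := h2.merge (by simp) (by simp [hc]; omega) (by simp)
      have := (hm2.symm.collapse (hM.collapse_of_two_le (by simp; omega))).expand hM (by simp [hcs, hy])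
      simpa using this
    · have hx := Agree.collapse_of_pos_prefix hM (p := p ++ [1]) (e := e) (f := f)
        (by simpa [hcs, hz] using hm) (fun n hn => he n (by simp at hn ⊢; tauto))
        (fun n hn => hf n (by simp at hn ⊢; tauto)) (by simp) hne
      have := Collapse.expand hM (p := p) (c := 1 :: c) (s := e) (by simpa [hcs] using hx)
        (by simp [hcs])
      simpa using this
  · have hx := (hm.collapse (hM.collapse_of_two_le (by simp; omega))).expand hM (by simp [hz])
    simpa using h'.symm.collapse hx

lemma Agree.collapse_of_ne (hM : SqCentral M) {e f : List ℕ} (h : Agree M e f) (hne : e ≠ f)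
    (he : 2 ≤ e.sum) (hf : 2 ≤ f.sum) : Collapse M e := by
  have big : ∀ l : List ℕ, (¬ ∀ n ∈ l, n ≤ 1) → Collapse M l := by
    intro l hl
    push Not at hl
    obtain ⟨n, hn, h2⟩ := hl
    obtain ⟨s, r, rfl⟩ := List.append_of_mem hn
    exact hM.collapse_of_two_le h2
  by_cases he1 : ∀ n ∈ e, n ≤ 1
  swap
  · exact big e he1
  by_cases hf1 : ∀ n ∈ f, n ≤ 1
  swap
  · exact h.symm.collapse (big f hf1)
  obtain ⟨p, a, b, e, f, rfl, rfl, hab⟩ := exists_first_ne e f h.1 hne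
  rcases Nat.eq_zero_or_pos p.sum with hp | hp
  · have ha := he1 a (by simp)
    have hb := hf1 b (by simp)
    obtain ⟨rfl, rfl⟩ | ⟨rfl, rfl⟩ : (a = 1 ∧ b = 0) ∨ (a = 0 ∧ b = 1) := by omega
    · exact h.collapse_of_zero_prefix hM he1 hf1 he hf hp
    · exact h.symm.collapse (h.symm.collapse_of_zero_prefix hM hf1 he1 hf he hp)
  · exact h.collapse_of_pos_prefix hM he1 hf1 hp (by simp [hab])

lemma prod_map_filter_eq (P : ℕ → Bool) (φ : ℕ → M) (u : List ℕ) :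
    ((u.filter P).map φ).prod = (u.map fun n => if P n then φ n else 1).prod := by
  induction u with
  | nil => rfl
  | cons a u ih => by_cases h : P a <;> simp [h, ih]

lemma Sat.filter {u v : List ℕ} (h : Sat M u v) (P : ℕ → Bool) :
    Sat M (u.filter P) (v.filter P) := fun φ => by
  rw [prod_map_filter_eq, prod_map_filter_eq, h]

lemma prod_map_eq_pow_count {φ : ℕ → M} {c : ℕ} {u : List ℕ}
    (h : ∀ n ∈ u, n ≠ c → φ n = 1) : (u.map φ).prod = φ c ^ u.count c := by
  induction u with
  | nil => simp
  | cons a u ih =>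
    rw [List.map_cons, List.prod_cons, ih fun n hn => h n (List.mem_cons_of_mem _ hn)]
    by_cases hac : a = c
    · subst hac
      simp [pow_succ']
    · simp [hac, h a (by simp) hac]

lemma Sat.eq_or_comm_of_perm {u v : List ℕ} (h : Sat M u v) (hu : u.Nodup) (hp : u.Perm v) :
    u = v ∨ ∀ a b : M, a * b = b * a := by
  induction u generalizing v with
  | nil => exact Or.inl (List.nil_perm.1 hp).symm
  | cons c u ih =>
    obtain ⟨d, v, rfl⟩ := List.exists_cons_of_length_eq_add_one hp.length_eq.symm
    have hv := hp.nodup_iff.1 hu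
    rw [List.nodup_cons] at hu hv
    by_cases hcd : c = d
    · subst hcd
      have hf := h.filter (fun n => n ≠ c)
      have key : ∀ l : List ℕ, c ∉ l → (c :: l).filter (fun n => n ≠ c) = l := by
        intro l hl
        rw [List.filter_cons_of_neg (by simp), List.filter_eq_self]
        rintro n hn
        simpa using fun e : n = c => hl (e ▸ hn)
      rw [key u hu.1, key v hv.1] at hf
      rcases ih hf hu.2 (List.perm_cons _ |>.1 hp) with rfl | hc
      · exact Or.inl rfl
      · exact Or.inr hc
    · refine Or.inr fun a b => ?_
      have hdu : d ∈ u := by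
        have := hp.mem_iff.2 (List.mem_cons_self (a := d) (l := v))
        simpa [Ne.symm hcd] using this
      have hcv : c ∈ v := by
        have := hp.mem_iff.1 (List.mem_cons_self (a := c) (l := u))
        simpa [hcd] using this
      have hh := h fun n => if n = c then a else if n = d then b else 1
      simp only [List.map_cons, List.prod_cons] at hh
      rw [prod_map_eq_pow_count (c := d) (u := u), prod_map_eq_pow_count (c := c) (u := v),
        List.count_eq_one_of_mem hu.2 hdu,
        List.count_eq_one_of_mem hv.2 hcv] at hh
      · simpa [hcd, Ne.symm hcd] using hh
      · intro n hn hnc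
        have : n ≠ d := fun e => hv.1 (e ▸ hn)
        simp [hnc, this]
      · intro n hn hnd
        have : n ≠ c := fun e => hu.1 (e ▸ hn)
        simp [hnd, this]

lemma Sat.eq_or_comm (hM : SqCentral M) {u v : List ℕ} (h : Sat M u v) (hu : u.Nodup) :
    u = v ∨ ∀ a b : M, a * b = b * a := by
  by_cases hc : ∀ c, u.count c = v.count c
  · exact h.eq_or_comm_of_perm hu (List.perm_iff_count.2 hc)
  · push Not at hc
    obtain ⟨c, hc⟩ := hc
    refine Or.inr (hM.comm_of_pow_eq (List.nodup_iff_count_le_one.1 hu c) hc fun X => ?_)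
    have := h fun n => if n = c then X else 1
    rwa [prod_map_eq_pow_count (c := c) (by simp +contextual),
      prod_map_eq_pow_count (c := c) (by simp +contextual), if_pos rfl] at this

@[simp] lemma blockWord_nil (ts : List ℕ) : blockWord [] ts = [] := by simp [blockWord]

@[simp] lemma blockWord_cons (b : List ℕ) (bs : List (List ℕ)) (t : ℕ) (ts : List ℕ) :
    blockWord (b :: bs) (t :: ts) = b ++ t :: blockWord bs ts := by
  simp [blockWord]

lemma blockWord_append (bs cs : List (List ℕ)) (ts us : List ℕ) (h : ts.length = bs.length) :
    blockWord (bs ++ cs) (ts ++ us) = blockWord bs ts ++ blockWord cs us := by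
  simp [blockWord, List.zipWith_append h.symm]

lemma filter_blockWord (P : ℕ → Bool) (bs : List (List ℕ)) (ts : List ℕ)
    (h : ts.length = bs.length) (hb : ∀ b ∈ bs, ∀ n ∈ b, ¬ P n) (ht : ∀ t ∈ ts, P t) :
    (blockWord bs ts).filter P = ts := by
  induction bs generalizing ts with
  | nil => simp_all
  | cons b bs ih =>
    obtain ⟨t, ts, rfl⟩ := List.exists_cons_of_length_eq_add_one h
    have hb0 : b.filter P = [] := List.filter_eq_nil_iff.2 (hb b (by simp))
    rw [blockWord_cons, List.filter_append, hb0, List.nil_append,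
      List.filter_cons_of_pos (ht t (by simp)),
      ih ts (by simpa using h) (fun c hc => hb c (List.mem_cons_of_mem _ hc))
        fun s hs => ht s (List.mem_cons_of_mem _ hs)]

lemma exists_blockWord (P : ℕ → Bool) (ts v : List ℕ) (h : v.filter P = ts) :
    ∃ cs r, cs.length = ts.length ∧ v = blockWord cs ts ++ r ∧
      (∀ c ∈ cs, ∀ n ∈ c, ¬ P n) ∧ ∀ n ∈ r, ¬ P n := by
  induction ts generalizing v with
  | nil => exact ⟨[], v, rfl, rfl, by simp, List.filter_eq_nil_iff.1 h⟩
  | cons t ts ih =>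
    obtain ⟨c, v, rfl, hc, -, hv⟩ := List.filter_eq_cons_iff.1 h
    obtain ⟨cs, r, hl, rfl, hcs, hr⟩ := ih v hv
    refine ⟨c :: cs, r, by simp [hl], by simp, ?_, hr⟩
    rintro d hd
    rcases List.mem_cons.1 hd with rfl | hd
    · exact hc
    · exact hcs d hd

lemma prod_map_blockWord (φ : ℕ → M) (z : ℕ) (bs : List (List ℕ)) (ts : List ℕ)
    (h : ∀ b ∈ bs, ∀ n ∈ b, n ≠ z → φ n = 1) :
    ((blockWord bs ts).map φ).prod = powerProd (φ z) (bs.map (List.count z)) (ts.map φ) := by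
  induction bs generalizing ts with
  | nil => simp
  | cons b bs ih =>
    rcases ts with _ | ⟨t, ts⟩
    · simp [blockWord, powerProd]
    · simp [ih ts fun c hc => h c (List.mem_cons_of_mem _ hc), prod_map_eq_pow_count (h b (by simp)),
        mul_assoc]

lemma Sat.agree_count {bs cs : List (List ℕ)} {ts : List ℕ}
    (h : Sat M (blockWord bs ts) (blockWord cs ts)) (hts : ts.Nodup)
    (hb : bs.length = ts.length) (hc : cs.length = ts.length) (z : ℕ) (hz : z ∉ ts)
    (hbt : ∀ b ∈ bs, ∀ n ∈ b, n ∉ ts) (hct : ∀ c ∈ cs, ∀ n ∈ c, n ∉ ts) :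
    Agree M (bs.map (List.count z)) (cs.map (List.count z)) := by
  refine ⟨by simp [hb, hc], fun X gs hg => ?_⟩
  obtain ⟨φ, h1, h2⟩ := exists_map_eq (fun n => if n = z then X else 1) ts hts gs
    (by simpa [hb] using hg)
  have h3 := h φ
  have hφ : ∀ ds : List (List ℕ), (∀ d ∈ ds, ∀ n ∈ d, n ∉ ts) →
      ∀ d ∈ ds, ∀ n ∈ d, n ≠ z → φ n = 1 := fun ds hd d hm n hn hnz => by
    rw [h2 n (hd d hm n hn), if_neg hnz]
  rwa [prod_map_blockWord φ z bs ts (hφ bs hbt), prod_map_blockWord φ z cs ts (hφ cs hct), h1,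
    h2 z hz, if_pos rfl] at h3

lemma exists_powerProd_of_letters (φ : ℕ → M) (z : ℕ) (ps ts : List ℕ)
    (h : ts.length = ps.length) :
    ∃ gs : List M, gs.length = ps.length ∧
      ((blockWord (ps.map fun n => [n]) ts).map φ).prod =
        powerProd (φ z) ((ps.map fun n => [n]).map (List.count z)) gs := by
  induction ps generalizing ts with
  | nil => exact ⟨[], by simp⟩
  | cons a ps ih =>
    obtain ⟨t, ts, rfl⟩ := List.exists_cons_of_length_eq_add_one h
    obtain ⟨gs, hl, hgs⟩ := ih ts (by simpa using h)
    by_cases haz : a = z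
    · subst haz
      refine ⟨φ t :: gs, by simp [hl], ?_⟩
      simp [mul_assoc, hgs]
    · refine ⟨(φ a * φ t) :: gs, by simp [hl], ?_⟩
      simp [mul_assoc, haz, hgs]

lemma Collapse.sat_swap (hM : SqCentral M) {z y : ℕ} {ps qs tp tq : List ℕ}
    (t : ℕ) (hp : tp.length = ps.length) (hq : tq.length = qs.length) {b : List ℕ}
    (hb : b.count z = 1)
    (hc : Collapse M (((ps.map fun n => [n]) ++ b :: qs.map fun n => [n]).map (List.count z))) :
    Sat M (blockWord ((ps.map fun n => [n]) ++ [z, y] :: qs.map fun n => [n]) (tp ++ t :: tq))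
      (blockWord ((ps.map fun n => [n]) ++ [y, z] :: qs.map fun n => [n]) (tp ++ t :: tq)) := by
  intro φ
  obtain ⟨gp, hgp, hP⟩ := exists_powerProd_of_letters φ z ps tp hp
  obtain ⟨gq, hgq, hQ⟩ := exists_powerProd_of_letters φ z qs tq hq
  rw [List.map_append, List.map_cons, hb] at hc
  have h1 := hc.insert hM (φ z) gp 1 (φ y * φ t) gq (by simp [hgp]) (by simp [hgq])
  have h2 := hc.insert hM (φ z) gp (φ y) (φ t) gq (by simp [hgp]) (by simp [hgq])
  rw [← hP, ← hQ] at h1 h2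
  rw [blockWord_append _ _ _ _ (by simp [hp]), blockWord_append _ _ _ _ (by simp [hp])]
  simp only [blockWord_cons, List.map_append, List.map_cons, List.prod_append,
    List.prod_cons, List.cons_append, List.nil_append, mul_assoc, mul_one, pow_one]
    at h1 h2 ⊢
  rw [h1, h2]

lemma map_singleton_eq_of_perm (ps : List ℕ) (cs : List (List ℕ))
    (h : List.Forall₂ List.Perm (ps.map fun n => [n]) cs) : cs = ps.map fun n => [n] := by
  induction ps generalizing cs with
  | nil => simpa using h
  | cons a ps ih =>
    rw [List.map_cons, List.forall₂_cons_left_iff] at h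
    obtain ⟨c, cs, h1, h2, rfl⟩ := h
    rw [ih cs h2, ← List.singleton_perm.1 h1, List.map_cons]

lemma forall₂_perm_of_count (bs cs : List (List ℕ))
    (hb : ∀ b ∈ bs, ∀ n ∈ b, n = 0 ∨ n = 1) (hc : ∀ c ∈ cs, ∀ n ∈ c, n = 0 ∨ n = 1)
    (h0 : bs.map (List.count 0) = cs.map (List.count 0))
    (h1 : bs.map (List.count 1) = cs.map (List.count 1)) : List.Forall₂ List.Perm bs cs := by
  induction bs generalizing cs with
  | nil =>
    obtain rfl : cs = [] := by simpa using h0.symm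
    exact List.Forall₂.nil
  | cons b bs ih =>
    rcases cs with _ | ⟨c, cs⟩
    · simp at h0
    simp only [List.map_cons, List.cons.injEq] at h0 h1
    refine List.Forall₂.cons (List.perm_iff_count.2 fun n => ?_)
      (ih cs (fun d hd => hb d (List.mem_cons_of_mem _ hd))
        (fun d hd => hc d (List.mem_cons_of_mem _ hd)) h0.2 h1.2)
    by_cases hn : n = 0 ∨ n = 1
    · rcases hn with rfl | rfl
      · exact h0.1
      · exact h1.1
    · rw [List.count_eq_zero_of_not_mem fun h => hn (hb b (by simp) n h),
        List.count_eq_zero_of_not_mem fun h => hn (hc c (by simp) n h)]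

lemma sum_map_count_letters (z : ℕ) (ps : List ℕ) :
    ((ps.map fun n => [n]).map (List.count z)).sum = ps.count z := by
  induction ps with
  | nil => rfl
  | cons a ps ih =>
    simp only [List.map_cons, List.sum_cons, ih, List.count_cons, List.count_nil]
    omega

lemma powerProd_ones (X : M) (es : List ℕ) :
    powerProd X es (List.replicate es.length 1) = X ^ es.sum := by
  induction es with
  | nil => simp
  | cons e es ih => simp [List.replicate_succ, ih, pow_add]

lemma Agree.collapse_or_comm (hM : SqCentral M) {e f : List ℕ} (h : Agree M e f) (hne : e ≠ f)
    (he : 2 ≤ e.sum) : Collapse M e ∨ ∀ a b : M, a * b = b * a := by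
  by_cases hf : 2 ≤ f.sum
  · exact Or.inl (h.collapse_of_ne hM hne he hf)
  · refine Or.inr (hM.comm_of_pow_eq (i := f.sum) (j := e.sum) (by omega) (by omega) fun X => ?_)
    have := h.2 X (List.replicate e.length 1) (by simp)
    rw [powerProd_ones, h.1, powerProd_ones] at this
    exact this.symm

lemma sat_swap_of_comm (hcomm : ∀ a b : M, a * b = b * a) {ps qs : List (List ℕ)}
    {tp tq : List ℕ} (t : ℕ) (hp : tp.length = ps.length) :
    Sat M (blockWord (ps ++ [0, 1] :: qs) (tp ++ t :: tq))
      (blockWord (ps ++ [1, 0] :: qs) (tp ++ t :: tq)) := by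
  intro φ
  rw [blockWord_append _ _ _ _ hp, blockWord_append _ _ _ _ hp]
  simp only [blockWord_cons, List.map_append, List.map_cons, List.prod_append,
    List.prod_cons, List.cons_append, List.nil_append]
  rw [← mul_assoc (φ 0), hcomm (φ 0), mul_assoc]

lemma perm_pair {c : List ℕ} (h : [0, 1].Perm c) : c = [0, 1] ∨ c = [1, 0] := by
  obtain ⟨a, b, rfl⟩ := List.length_eq_two.1 h.length_eq.symm
  have h0 := h.mem_iff (a := 0)
  have h1 := h.mem_iff (a := 1)
  simp only [List.mem_cons, List.not_mem_nil, or_false, List.cons.injEq, and_true] at h0 h1 ⊢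
  grind

/-- If `M` satisfies a nontrivial identity `w ≈ v` with `w` the word of the lemma (multiplied by
an additional simple letter), then `M` satisfies the identity swapping the adjacent `x` and `y`. -/
lemma sat_swap_of_not_isoterm (hM : SqCentral M) {ps qs tp tq : List ℕ} {t : ℕ}
    {cs : List (List ℕ)} (hp : tp.length = ps.length) (hq : tq.length = qs.length)
    (hps : ∀ n ∈ ps, n = 0 ∨ n = 1) (hqs : ∀ n ∈ qs, n = 0 ∨ n = 1)
    (h0 : 0 ∈ ps ++ qs) (h1 : 1 ∈ ps ++ qs)
    (hts : (tp ++ t :: tq).Nodup) (ht : ∀ n ∈ tp ++ t :: tq, ¬ (n = 0 ∨ n = 1))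
    (hcl : cs.length = (tp ++ t :: tq).length) (hcs : ∀ c ∈ cs, ∀ n ∈ c, n = 0 ∨ n = 1)
    (hne : blockWord cs (tp ++ t :: tq) ≠
      blockWord ((ps.map fun n => [n]) ++ [0, 1] :: qs.map fun n => [n]) (tp ++ t :: tq))
    (hsat : Sat M
      (blockWord ((ps.map fun n => [n]) ++ [0, 1] :: qs.map fun n => [n]) (tp ++ t :: tq))
      (blockWord cs (tp ++ t :: tq))) :
    Sat M (blockWord ((ps.map fun n => [n]) ++ [0, 1] :: qs.map fun n => [n]) (tp ++ t :: tq))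
      (blockWord ((ps.map fun n => [n]) ++ [1, 0] :: qs.map fun n => [n]) (tp ++ t :: tq)) := by
  set bs := (ps.map fun n => [n]) ++ [0, 1] :: qs.map fun n => [n] with hbs
  have hbl : bs.length = (tp ++ t :: tq).length := by simp [hbs, hp, hq]
  have hb : ∀ b ∈ bs, ∀ n ∈ b, n = 0 ∨ n = 1 := by
    intro b hb n hn
    simp only [hbs, List.mem_append, List.mem_map, List.mem_cons] at hb
    rcases hb with ⟨m, hm, rfl⟩ | rfl | ⟨m, hm, rfl⟩
    · exact List.mem_singleton.1 hn ▸ hps m hm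
    · simpa using hn
    · exact List.mem_singleton.1 hn ▸ hqs m hm
  have hagree : ∀ z, z = 0 ∨ z = 1 → Agree M (bs.map (List.count z)) (cs.map (List.count z)) :=
    fun z hz => hsat.agree_count hts hbl hcl z (fun h => ht z h hz)
      (fun b hm n hn h => ht n h (hb b hm n hn)) (fun c hm n hn h => ht n h (hcs c hm n hn))
  have hsum : ∀ z, z = 0 ∨ z = 1 → z ∈ ps ++ qs → 2 ≤ (bs.map (List.count z)).sum := by
    intro z hz hmem
    have hcount := List.count_pos_iff.2 hmem
    have h01 : List.count z [0, 1] = 1 := by rcases hz with rfl | rfl <;> rfl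
    rw [List.count_append] at hcount
    rw [hbs, List.map_append, List.map_cons, List.sum_append, List.sum_cons,
      sum_map_count_letters, sum_map_count_letters, h01]
    omega
  by_cases e0 : bs.map (List.count 0) = cs.map (List.count 0)
  swap
  · rcases (hagree 0 (Or.inl rfl)).collapse_or_comm hM e0 (hsum 0 (Or.inl rfl) h0) with hc | hc
    · exact Collapse.sat_swap hM t hp hq (by simp) hc
    · exact sat_swap_of_comm hc t (by simpa using hp)
  by_cases e1 : bs.map (List.count 1) = cs.map (List.count 1)
  swap
  · rcases (hagree 1 (Or.inr rfl)).collapse_or_comm hM e1 (hsum 1 (Or.inr rfl) h1) with hc | hc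
    · exact fun φ => (Collapse.sat_swap hM t hp hq (by simp) hc φ).symm
    · exact sat_swap_of_comm hc t (by simpa using hp)
  have hperm := forall₂_perm_of_count bs cs hb hcs e0 e1
  obtain ⟨cp, c, cq, rfl, hcp, hcq⟩ := exists_append_cons_of_length
    (gs := cs) (m := ps.length) (n := qs.length) (by simpa [hp, hq] using hcl)
  rw [hbs] at hperm
  obtain ⟨hP, hR⟩ : List.Forall₂ List.Perm (ps.map fun n => [n]) cp ∧
      List.Forall₂ List.Perm ([0, 1] :: qs.map fun n => [n]) (c :: cq) :=
    ⟨by simpa [hcp] using List.forall₂_take ps.length hperm,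
      by simpa [hcp] using List.forall₂_drop ps.length hperm⟩
  obtain ⟨hC, hQ⟩ := List.forall₂_cons.1 hR
  obtain rfl := map_singleton_eq_of_perm ps cp hP
  obtain rfl := map_singleton_eq_of_perm qs cq hQ
  rcases perm_pair hC with rfl | rfl
  · exact absurd rfl hne
  · exact hsat

end SquareCentral

lemma sqCentral_quotient {θ : Con FM} (hθ : IsFullyInvariant θ) (hA : θA ≤ θ) :
    SqCentral θ.Quotient := by
  have base : ∀ p ∈ ({(xL ^ 2, xL ^ 3), (xL ^ 2 * yL, yL * xL ^ 2)} : Set (FM × FM)),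
      θ p.1 p.2 := by
    intro p hp
    refine hA ?_
    intro c hc
    exact hc.2 p hp
  intro x
  induction x using Con.induction_on with | _ a
  refine ⟨?_, fun y => ?_⟩
  · have := hθ (FreeMonoid.lift fun _ => a) _ _ (base (xL ^ 2, xL ^ 3) (by simp))
    simp only [map_pow, xL, FreeMonoid.lift_eval_of] at this
    exact ((Con.eq θ).2 this).symm
  · induction y using Con.induction_on with | _ b
    have := hθ (FreeMonoid.lift fun n => if n = 0 then a else b) _ _
      (base (xL ^ 2 * yL, yL * xL ^ 2) (by simp))
    simp only [map_pow, map_mul, xL, yL, FreeMonoid.lift_eval_of] at this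
    exact (Con.eq θ).2 this

lemma mk_lift_eq (θ : Con FM) (σ : ℕ → FM) (u : FM) :
    ((FreeMonoid.lift σ u : FM) : θ.Quotient) =
      ((FreeMonoid.toList u).map fun n => ((σ n : FM) : θ.Quotient)).prod := by
  have := DFunLike.congr_fun (FreeMonoid.comp_lift θ.mk' σ) u
  rw [FreeMonoid.lift_apply] at this
  exact this

lemma sat_quotient_iff {θ : Con FM} (hθ : IsFullyInvariant θ) (u v : FM) :
    Sat θ.Quotient (FreeMonoid.toList u) (FreeMonoid.toList v) ↔ θ u v := by
  constructor
  · intro h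
    have := h fun n => ((FreeMonoid.of n : FM) : θ.Quotient)
    rw [← mk_lift_eq, ← mk_lift_eq] at this
    have hid : FreeMonoid.lift FreeMonoid.of = MonoidHom.id FM :=
      FreeMonoid.hom_eq fun n => by simp
    rw [hid] at this
    exact (Con.eq θ).1 this
  · intro h φ
    choose σ hσ using fun n => Con.mk'_surjective (φ n)
    have := (Con.eq θ).2 (hθ (FreeMonoid.lift σ) u v h)
    rw [mk_lift_eq, mk_lift_eq] at this
    have hφ : (fun n => ((σ n : FM) : θ.Quotient)) = φ := funext hσ
    rwa [hφ] at this

lemma exists_ne_of_not_satisfies {θ : Con FM} (hθ : IsFullyInvariant θ) (w : FM)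
    (h : ∃ u v : FM, θ u v ∧ ¬ MSatisfies (SMon w) (u, v)) : ∃ w', w' ≠ w ∧ θ w w' := by
  obtain ⟨u, v, huv, h⟩ := h
  have h : ¬ ∀ φ : FM →* SMon w, φ u = φ v := h
  push Not at h
  obtain ⟨φ, hφ⟩ := h
  choose σ hσ using fun n => Con.mk'_surjective (φ (FreeMonoid.of n))
  have hcomp : (reesCon w).mk'.comp (FreeMonoid.lift σ) = φ := by
    refine FreeMonoid.hom_eq fun n => ?_
    simpa using hσ n
  have hθ' := hθ (FreeMonoid.lift σ) u v huv
  rw [← hcomp] at hφ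
  have hnot : ¬ reesCon w (FreeMonoid.lift σ u) (FreeMonoid.lift σ v) :=
    fun h => hφ ((Con.eq _).2 h)
  generalize FreeMonoid.lift σ u = u' at *
  generalize FreeMonoid.lift σ v = v' at *
  have aux : ∀ a b : FM, θ a b → a ≠ b → IsFactor a w → ∃ w', w' ≠ w ∧ θ w w' := by
    rintro a b hab hne ⟨c, d, rfl⟩
    exact ⟨c * b * d, fun h => hne (mul_left_cancel (mul_right_cancel h)).symm,
      θ.mul (θ.mul (θ.refl c) hab) (θ.refl d)⟩
  have hne : u' ≠ v' := fun h => hnot (Or.inl h)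
  by_cases hu : IsFactor u' w
  · exact aux u' v' hθ' hne hu
  · by_cases hv : IsFactor v' w
    · exact aux v' u' (θ.symm hθ') hne.symm hv
    · exact absurd (Or.inr ⟨hu, hv⟩) hnot

lemma toList_prodRange_left (α τ : ℕ → ℕ) (k : ℕ) :
    FreeMonoid.toList (prodRange k fun i => FreeMonoid.of (α i) * FreeMonoid.of (τ i)) =
      blockWord (((List.range k).map α).map fun n => [n]) ((List.range k).map τ) := by
  induction k with
  | zero => rfl
  | succ k ih =>
    simp only [prodRange] at ih ⊢
    rw [List.range_succ]
    simp only [List.map_append, List.prod_append, FreeMonoid.toList_mul, ih]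
    rw [blockWord_append _ _ _ _ (by simp)]
    simp [FreeMonoid.toList_of]

lemma toList_prodRange_right (α τ : ℕ → ℕ) (l : ℕ) :
    FreeMonoid.toList (prodRange l fun i => FreeMonoid.of (τ i) * FreeMonoid.of (α i)) ++ [τ l] =
      τ 0 :: blockWord (((List.range l).map α).map fun n => [n])
        ((List.range l).map fun i => τ (i + 1)) := by
  induction l with
  | zero => rfl
  | succ l ih =>
    simp only [prodRange] at ih ⊢
    rw [List.range_succ]
    simp only [List.map_append, List.prod_append, FreeMonoid.toList_mul]
    rw [blockWord_append _ _ _ _ (by simp), ← List.cons_append, ← ih]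
    simp [FreeMonoid.toList_of]

lemma prodRange_congr {n : ℕ} {f g : ℕ → FM} (h : ∀ i < n, f i = g i) :
    prodRange n f = prodRange n g := by
  rw [prodRange, prodRange, List.map_congr_left fun i hi => h i (List.mem_range.1 hi)]

/-- **Lemma 3.5.** Let `V ⊆ A`, let `p = a₁t₁⋯a_k t_k` and
`q = t_{k+1}a_{k+1}⋯t_{k+ℓ}a_{k+ℓ}` where each `a_i ∈ {x, y}` and both `x` and `y`
occur among the `a_i`. If `S(pxyq)` does not lie in `V`, then `V` satisfies
`pxyq ≈ pyxq`. -/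
theorem lemma_3_5 (θ : Con FM) (hθ : IsFullyInvariant θ) (hA : θA ≤ θ)
    (k l : ℕ) (a : ℕ → FM)
    (ha : ∀ i < k + l, a i = xL ∨ a i = yL)
    (hax : ∃ i < k + l, a i = xL) (hay : ∃ i < k + l, a i = yL)
    (p q : FM)
    (hp : p = prodRange k (fun i => a i * tV i))
    (hq : q = prodRange l (fun i => tV (k + i) * a (k + i)))
    (hS : ∃ u v : FM, θ u v ∧ ¬ MSatisfies (SMon (p * xL * yL * q)) (u, v)) :
    θ (p * xL * yL * q) (p * yL * xL * q) := by
  classical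
  obtain ⟨w', hne, hww⟩ := exists_ne_of_not_satisfies hθ _ hS
  have hM := sqCentral_quotient hθ hA
  set α : ℕ → ℕ := fun i => if a i = xL then 0 else 1 with hα
  set τ : ℕ → ℕ := fun i => 11 + 2 * i with hτ
  have hαa : ∀ i < k + l, a i = FreeMonoid.of (α i) := by
    intro i hi
    by_cases h : a i = xL
    · simp [hα, h, xL]
    · simpa [hα, h, yL] using (ha i hi).resolve_left h
  have hα01 : ∀ i, α i = 0 ∨ α i = 1 := fun i => by
    by_cases h : a i = xL <;> simp [hα, h]
  set ps := (List.range k).map α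
  set qs := (List.range l).map fun i => α (k + i)
  set tp := (List.range k).map τ
  set tq := (List.range l).map fun i => τ (k + (i + 1))
  have hword : ∀ b c : ℕ,
      FreeMonoid.toList (p * FreeMonoid.of b * FreeMonoid.of c * q) ++ [τ (k + l)] =
        blockWord ((ps.map fun n => [n]) ++ [b, c] :: qs.map fun n => [n]) (tp ++ τ k :: tq) := by
    intro b c
    have h1 := toList_prodRange_left α τ k
    have h2 := toList_prodRange_right (fun i => α (k + i)) (fun i => τ (k + i)) l
    rw [blockWord_append _ _ _ _ (by simp [ps, tp]), blockWord_cons]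
    rw [prodRange_congr (g := fun i => a i * tV i) fun i hi => by
      rw [hαa i (by omega)]; rfl, ← hp] at h1
    rw [prodRange_congr (g := fun i => tV (k + i) * a (k + i)) fun i hi => by
      rw [hαa (k + i) (by omega)]; rfl, ← hq] at h2
    rw [← h1]
    simp only [add_zero] at h2
    rw [← h2]
    simp [FreeMonoid.toList_of]
  have hmem : ∀ i < k + l, α i ∈ ps ++ qs := by
    intro i hi
    rw [List.mem_append]
    by_cases hik : i < k
    · exact Or.inl (List.mem_map.2 ⟨i, List.mem_range.2 hik, rfl⟩)
    · exact Or.inr (List.mem_map.2 ⟨i - k, List.mem_range.2 (by omega), by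
        rw [Nat.add_sub_cancel' (by omega)]⟩)
  have h0 : 0 ∈ ps ++ qs := by
    obtain ⟨i, hi, h⟩ := hax
    have := hmem i hi
    rwa [show α i = 0 by simp [hα, h]] at this
  have h1 : 1 ∈ ps ++ qs := by
    obtain ⟨i, hi, h⟩ := hay
    have hyx : yL ≠ xL := fun e => one_ne_zero (FreeMonoid.of_injective e)
    have := hmem i hi
    rwa [show α i = 1 by simp [hα, h, hyx]] at this
  have hts_eq : tp ++ τ k :: tq = ((List.range (k + (l + 1))).map τ) := by
    rw [List.range_add, List.range_succ_eq_map]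
    simp [tp, tq, Function.comp_def]
  have hts_eq' : tp ++ τ k :: tq = ((List.range (k + l)).map τ) ++ [τ (k + l)] := by
    rw [hts_eq, ← add_assoc, List.range_succ]
    simp
  have hτ_inj : Function.Injective τ := fun i j h => by simp only [hτ] at h; omega
  have hts : (tp ++ τ k :: tq).Nodup := by
    rw [hts_eq]
    exact List.nodup_range.map hτ_inj
  have ht : ∀ n ∈ tp ++ τ k :: tq, ¬ (n = 0 ∨ n = 1) := by
    intro n hn
    rw [hts_eq, List.mem_map] at hn
    obtain ⟨i, -, rfl⟩ := hn
    simp only [hτ]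
    omega
  set P : ℕ → Bool := fun n => decide (¬ (n = 0 ∨ n = 1)) with hP
  have hPτ : P (τ (k + l)) := by simp only [hP, hτ, decide_eq_true_eq]; omega
  have hfilter : ∀ b c : ℕ, (b = 0 ∨ b = 1) → (c = 0 ∨ c = 1) →
      (FreeMonoid.toList (p * FreeMonoid.of b * FreeMonoid.of c * q)).filter P =
        (List.range (k + l)).map τ := by
    intro b c hb hc
    have := congrArg (List.filter P) (hword b c)
    rw [filter_blockWord P _ _ (by simp [tp, tq, ps, qs]) ?_ (fun n hn => by
      simpa only [hP, decide_eq_true_eq] using ht n hn), hts_eq', List.filter_append] at this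
    · rw [List.filter_cons_of_pos hPτ, List.filter_nil] at this
      exact List.append_cancel_right this
    · intro d hd n hn
      simp only [List.mem_append, List.mem_map, List.mem_cons, ps, qs] at hd
      have hn01 : n = 0 ∨ n = 1 := by
        rcases hd with ⟨_, ⟨i, -, rfl⟩, rfl⟩ | rfl | ⟨_, ⟨i, -, rfl⟩, rfl⟩
        · rw [List.mem_singleton.1 hn]; exact hα01 i
        · simp only [List.mem_cons, List.not_mem_nil, or_false] at hn
          rcases hn with rfl | rfl <;> assumption
        · rw [List.mem_singleton.1 hn]; exact hα01 (k + i)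
      simp only [hP, decide_eq_true_eq, not_not]
      exact hn01
  suffices hswap : Sat θ.Quotient
      (blockWord ((ps.map fun n => [n]) ++ [0, 1] :: qs.map fun n => [n]) (tp ++ τ k :: tq))
      (blockWord ((ps.map fun n => [n]) ++ [1, 0] :: qs.map fun n => [n]) (tp ++ τ k :: tq)) by
    rw [← hword, ← hword] at hswap
    have hs := hswap.filter fun n => n ≠ τ (k + l)
    have key : ∀ b c : ℕ, (b = 0 ∨ b = 1) → (c = 0 ∨ c = 1) →
        (FreeMonoid.toList (p * FreeMonoid.of b * FreeMonoid.of c * q) ++ [τ (k + l)]).filter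
          (fun n => n ≠ τ (k + l)) =
        FreeMonoid.toList (p * FreeMonoid.of b * FreeMonoid.of c * q) := by
      intro b c hb hc
      rw [List.filter_append, List.filter_cons_of_neg (by simp), List.filter_nil,
        List.append_nil, List.filter_eq_self]
      intro n hn
      rw [decide_eq_true_eq]
      rintro rfl
      have hm := List.mem_filter.2 ⟨hn, hPτ⟩
      rw [hfilter b c hb hc, List.mem_map] at hm
      obtain ⟨i, hi, h⟩ := hm
      have := hτ_inj h
      have := List.mem_range.1 hi
      omega
    rw [key 0 1 (Or.inl rfl) (Or.inr rfl), key 1 0 (Or.inr rfl) (Or.inl rfl),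
      sat_quotient_iff hθ] at hs
    exact hs
  have hsat := (sat_quotient_iff hθ _ _).2 hww
  rcases (hsat.filter P).eq_or_comm hM (by
    rw [show p * xL * yL * q = p * FreeMonoid.of 0 * FreeMonoid.of 1 * q from rfl,
      hfilter 0 1 (Or.inl rfl) (Or.inr rfl)]
    exact List.nodup_range.map hτ_inj) with hf | hcomm
  · rw [show p * xL * yL * q = p * FreeMonoid.of 0 * FreeMonoid.of 1 * q from rfl,
      hfilter 0 1 (Or.inl rfl) (Or.inr rfl)] at hf
    obtain ⟨cs, r, hcl, hw', hcs, hr⟩ := exists_blockWord P _ _ hf.symm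
    have hlast : FreeMonoid.toList w' ++ [τ (k + l)] =
        blockWord (cs ++ [r]) (tp ++ τ k :: tq) := by
      rw [hts_eq', blockWord_append _ _ _ _ hcl.symm, hw']
      simp
    refine sat_swap_of_not_isoterm hM (cs := cs ++ [r]) (by simp [tp, ps]) (by simp [tq, qs])
      ?_ ?_ h0 h1 hts ht (by simp [hts_eq', hcl]) ?_ ?_ ?_
    · simp only [ps, List.mem_map]
      rintro n ⟨i, -, rfl⟩
      exact hα01 i
    · simp only [qs, List.mem_map]
      rintro n ⟨i, -, rfl⟩
      exact hα01 (k + i)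
    · intro c hc n hn
      have : ¬ P n := by
        rcases List.mem_append.1 hc with hc | hc
        · exact hcs c hc n hn
        · rw [List.mem_singleton.1 hc] at hn
          exact hr n hn
      simpa only [hP, decide_eq_true_eq, not_not] using this
    · rw [← hlast, ← hword]
      intro h
      exact hne (FreeMonoid.toList.injective (List.append_cancel_right h))
    · rw [← hlast, ← hword]
      intro φ
      have := hsat φ
      rw [List.map_append, List.prod_append, List.map_append, List.prod_append, ← this]
      rfl
  · exact sat_swap_of_comm hcomm _ (by simp [tp, ps])
end
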